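/- arXiv:2112.09247 — 2 statements merged into one kernel-verified Lean document; each statement's English description precedes it below -/
import Mathlib

section
/- Let Ω ⊆ ℝⁿ be a bounded open set, R_Ω := sup_{x ∈ Ω} dist(x, ∂Ω), and Λ_max := 1/(e · R_Ω). Let Λ ∈ (0, Λ_max) and let (p_k) be a sequence of reals with p_k > 4, p_k → ∞, and let λ_k > 0 satisfy λ_k^{1/p_k}/p_k → Λ. For each k, let u_k be a continuous viscosity solution of −Δ_{p_k} u = λ_k e^{u} in Ω with u_k = 0 on ∂Ω that is minimal, i.e. u_k ≤ w for every continuous viscosity solution w of the same problem at parameter (p_k, λ_k). Let u_Λ be the minimal continuous viscosity solution of min{|∇u| − Λ e^{u}, −Δ_∞ u} = 0 in Ω with u_Λ = 0 on ∂Ω (meaning u_Λ is a solution and u_Λ ≤ u for every such solution u). Then u_k/p_k → u_Λ uniformly on closure(Ω) as k → ∞. -/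
open Real Set Metric Filter Topology

/-- `⟨D²φ(x)∇φ(x), ∇φ(x)⟩`, i.e. `Δ_∞φ(x)`. -/
noncomputable def hessQ {n : ℕ} (φ : EuclideanSpace ℝ (Fin n) → ℝ)
    (x : EuclideanSpace ℝ (Fin n)) : ℝ :=
  iteratedFDeriv ℝ 2 φ x ![gradient φ x, gradient φ x]

/-- Viscosity supersolution of `min{|∇u| − Λ e^u, −Δ_∞ u} = 0` in `Ω`. -/
def IsInftySuper {n : ℕ} (Ω : Set (EuclideanSpace ℝ (Fin n))) (Λ : ℝ)
    (u : EuclideanSpace ℝ (Fin n) → ℝ) : Prop :=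
  ∀ x₀ ∈ Ω, ∀ φ : EuclideanSpace ℝ (Fin n) → ℝ, ContDiff ℝ 2 φ →
    IsLocalMinOn (fun x => u x - φ x) Ω x₀ →
    (0 ≤ ‖gradient φ x₀‖ - Λ * Real.exp (u x₀) ∧ 0 ≤ -(hessQ φ x₀))

/-- Viscosity subsolution of `min{|∇u| − Λ e^u, −Δ_∞ u} = 0` in `Ω`. -/
def IsInftySub {n : ℕ} (Ω : Set (EuclideanSpace ℝ (Fin n))) (Λ : ℝ)
    (u : EuclideanSpace ℝ (Fin n) → ℝ) : Prop :=
  ∀ x₀ ∈ Ω, ∀ φ : EuclideanSpace ℝ (Fin n) → ℝ, ContDiff ℝ 2 φ →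
    IsLocalMaxOn (fun x => u x - φ x) Ω x₀ →
    min (‖gradient φ x₀‖ - Λ * Real.exp (u x₀)) (-(hessQ φ x₀)) ≤ 0

/-- Viscosity solution of `min{|∇u| − Λ e^u, −Δ_∞ u} = 0` in `Ω`. -/
def IsInftySol {n : ℕ} (Ω : Set (EuclideanSpace ℝ (Fin n))) (Λ : ℝ)
    (u : EuclideanSpace ℝ (Fin n) → ℝ) : Prop :=
  IsInftySuper Ω Λ u ∧ IsInftySub Ω Λ u

/-- The Laplacian `Δφ(x)`, as the trace of the Hessian. -/
noncomputable def lapl {n : ℕ} (φ : EuclideanSpace ℝ (Fin n) → ℝ)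
    (x : EuclideanSpace ℝ (Fin n)) : ℝ :=
  ∑ i : Fin n, iteratedFDeriv ℝ 2 φ x ![EuclideanSpace.single i 1, EuclideanSpace.single i 1]

/-- Viscosity supersolution of `−Δ_p u = λ e^u` in `Ω` (expanded form, for `p > 4`). -/
def IsPSuper {n : ℕ} (Ω : Set (EuclideanSpace ℝ (Fin n))) (p lam : ℝ)
    (u : EuclideanSpace ℝ (Fin n) → ℝ) : Prop :=
  ∀ x₀ ∈ Ω, ∀ φ : EuclideanSpace ℝ (Fin n) → ℝ, ContDiff ℝ 2 φ →
    IsLocalMinOn (fun x => u x - φ x) Ω x₀ →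
    lam * Real.exp (u x₀) ≤
      -(‖gradient φ x₀‖ ^ (p - 4) *
        (‖gradient φ x₀‖ ^ 2 * lapl φ x₀ + (p - 2) * hessQ φ x₀))

/-- Viscosity subsolution of `−Δ_p u = λ e^u` in `Ω` (expanded form, for `p > 4`). -/
def IsPSub {n : ℕ} (Ω : Set (EuclideanSpace ℝ (Fin n))) (p lam : ℝ)
    (u : EuclideanSpace ℝ (Fin n) → ℝ) : Prop :=
  ∀ x₀ ∈ Ω, ∀ φ : EuclideanSpace ℝ (Fin n) → ℝ, ContDiff ℝ 2 φ →
    IsLocalMaxOn (fun x => u x - φ x) Ω x₀ →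
    -(‖gradient φ x₀‖ ^ (p - 4) *
        (‖gradient φ x₀‖ ^ 2 * lapl φ x₀ + (p - 2) * hessQ φ x₀)) ≤
      lam * Real.exp (u x₀)

/-- Viscosity solution of `−Δ_p u = λ e^u` in `Ω`. -/
def IsPSol {n : ℕ} (Ω : Set (EuclideanSpace ℝ (Fin n))) (p lam : ℝ)
    (u : EuclideanSpace ℝ (Fin n) → ℝ) : Prop :=
  IsPSuper Ω p lam u ∧ IsPSub Ω p lam u

section Calculus

variable {H : Type*} [NormedAddCommGroup H] [InnerProductSpace ℝ H]

/-- The second directional derivative of a `C²` function along a line. -/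
theorem deriv_deriv_line {f : H → ℝ} {x : H} (hf : ContDiffAt ℝ 2 f x) (a : H) :
    deriv (fun t : ℝ => f (x + t • a)) 0 = fderiv ℝ f x a ∧
    deriv (deriv (fun t : ℝ => f (x + t • a))) 0 = iteratedFDeriv ℝ 2 f x ![a, a] := by
  have hline : ∀ t : ℝ, HasDerivAt (fun t : ℝ => x + t • a) a t := fun t => by
    simpa using ((hasDerivAt_id t).smul_const a).const_add x
  have hev : ∀ᶠ y in 𝓝 x, DifferentiableAt ℝ f y := by
    filter_upwards [hf.eventually (by simp)] with y hy using hy.differentiableAt (by simp)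
  have htend : Tendsto (fun t : ℝ => x + t • a) (𝓝 0) (𝓝 x) := by
    have := (hline 0).continuousAt
    simpa [ContinuousAt] using this
  have h1 : deriv (fun t : ℝ => f (x + t • a)) =ᶠ[𝓝 0] fun t => fderiv ℝ f (x + t • a) a := by
    filter_upwards [htend.eventually hev] with t ht
    exact (ht.hasFDerivAt.comp_hasDerivAt t (hline t)).deriv
  refine ⟨by simpa using h1.self_of_nhds, ?_⟩
  rw [h1.deriv_eq, iteratedFDeriv_two_apply]
  have h2 : DifferentiableAt ℝ (fderiv ℝ f) x :=
    (hf.fderiv_right (m := 1) (by norm_num)).differentiableAt (by simp)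
  have h2' : HasFDerivAt (fderiv ℝ f) (fderiv ℝ (fderiv ℝ f) x) (x + (0 : ℝ) • a) := by
    simpa using h2.hasFDerivAt
  have h3 := (h2'.comp_hasDerivAt (0 : ℝ) (hline 0))
  have h4 := h3.clm_apply (hasDerivAt_const (0 : ℝ) a)
  simpa using h4.deriv

/-- Second-order necessary condition at a local minimum. -/
theorem IsLocalMin.iteratedFDeriv_two_nonneg {f : H → ℝ} {x : H} (hf : ContDiffAt ℝ 2 f x)
    (h : IsLocalMin f x) (a : H) : 0 ≤ iteratedFDeriv ℝ 2 f x ![a, a] := by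
  obtain ⟨h1, h2⟩ := deriv_deriv_line hf a
  by_contra! hneg
  set g : ℝ → ℝ := fun t => f (x + t • a) with hg
  have hc0 : ContinuousAt (fun t : ℝ => x + t • a) 0 := by fun_prop
  have hc : ContinuousAt g 0 := by
    refine ContinuousAt.comp (g := f) ?_ hc0
    simpa using hf.continuousAt
  have hmin : IsLocalMin g 0 := by
    have : Tendsto (fun t : ℝ => x + t • a) (𝓝 0) (𝓝 x) := by simpa [ContinuousAt] using hc0
    filter_upwards [this.eventually h] with t ht
    simpa [hg] using ht
  have hmax : IsLocalMax g 0 := by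
    refine isLocalMax_of_deriv_deriv_neg (by rw [h2]; exact hneg) ?_ hc
    rw [h1, h.fderiv_eq_zero]; simp
  have hconst : g =ᶠ[𝓝 0] fun _ => g 0 := by
    filter_upwards [hmin, hmax] with t h1 h2 using le_antisymm h2 h1
  have : deriv (deriv g) 0 = 0 := by
    rw [hconst.deriv.deriv_eq]; simp
  rw [h2] at this
  exact hneg.ne this

theorem iteratedFDeriv_two_add {f g : H → ℝ} {x : H} (hf : ContDiffAt ℝ 2 f x)
    (hg : ContDiffAt ℝ 2 g x) (a : H) :
    iteratedFDeriv ℝ 2 (fun y => f y + g y) x ![a, a]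
      = iteratedFDeriv ℝ 2 f x ![a, a] + iteratedFDeriv ℝ 2 g x ![a, a] := by
  have := iteratedFDeriv_add_apply (𝕜 := ℝ) (i := 2) hf hg
  have h2 : (fun y => f y + g y) = f + g := rfl
  rw [h2, this]; rfl

theorem iteratedFDeriv_two_sub {f g : H → ℝ} {x : H} (hf : ContDiffAt ℝ 2 f x)
    (hg : ContDiffAt ℝ 2 g x) (a : H) :
    iteratedFDeriv ℝ 2 (fun y => f y - g y) x ![a, a]
      = iteratedFDeriv ℝ 2 f x ![a, a] - iteratedFDeriv ℝ 2 g x ![a, a] := by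
  have := iteratedFDeriv_sub_apply (𝕜 := ℝ) (i := 2) hf hg
  have h2 : (fun y => f y - g y) = f - g := rfl
  rw [h2, this]; rfl

/-- Chain rule for the Hessian of `G ∘ f`. -/
theorem iteratedFDeriv_two_comp {f : H → ℝ} {G G₁ : ℝ → ℝ} {G₂ : ℝ} {x : H}
    (hf : ContDiffAt ℝ 2 f x) (hG : ∀ᶠ t in 𝓝 (f x), HasDerivAt G (G₁ t) t)
    (hG₁ : HasDerivAt G₁ G₂ (f x)) (a : H) :
    iteratedFDeriv ℝ 2 (fun y => G (f y)) x ![a, a]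
      = G₁ (f x) * iteratedFDeriv ℝ 2 f x ![a, a] + G₂ * (fderiv ℝ f x a) ^ 2 := by
  have hev : ∀ᶠ y in 𝓝 x, DifferentiableAt ℝ f y := by
    filter_upwards [hf.eventually (by simp)] with y hy using hy.differentiableAt (by simp)
  have h1 : fderiv ℝ (fun y => G (f y)) =ᶠ[𝓝 x] fun y => G₁ (f y) • fderiv ℝ f y := by
    filter_upwards [hev, hf.continuousAt.eventually hG] with y hy hy2
    exact (hy2.comp_hasFDerivAt y hy.hasFDerivAt).fderiv
  have h2 : DifferentiableAt ℝ (fderiv ℝ f) x :=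
    (hf.fderiv_right (m := 1) (by norm_num)).differentiableAt (by simp)
  have h3 : HasFDerivAt (fun y => G₁ (f y)) (G₂ • fderiv ℝ f x) x :=
    hG₁.comp_hasFDerivAt x hev.self_of_nhds.hasFDerivAt
  have h4 := h3.smul h2.hasFDerivAt
  rw [iteratedFDeriv_two_apply, iteratedFDeriv_two_apply, h1.fderiv_eq]
  erw [h4.fderiv]
  simp
  ring

theorem hessian_norm_sq (z x a : H) :
    iteratedFDeriv ℝ 2 (fun y => ‖y - z‖ ^ 2) x ![a, a] = 2 * ‖a‖ ^ 2 := by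
  have h0 : ContDiff ℝ 2 (fun y : H => ‖y - z‖ ^ 2) := (contDiff_id.sub contDiff_const).norm_sq ℝ
  rw [← (deriv_deriv_line h0.contDiffAt a).2]
  have h1 : (fun t : ℝ => ‖x + t • a - z‖ ^ 2)
      = fun t => ‖x - z‖ ^ 2 + 2 * t * inner ℝ (x - z) a + t ^ 2 * ‖a‖ ^ 2 := by
    ext t
    rw [show x + t • a - z = (x - z) + t • a by abel, norm_add_sq_real, inner_smul_right,
      norm_smul, mul_pow, Real.norm_eq_abs, sq_abs]
    ring
  have h2 : ∀ t : ℝ, HasDerivAt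
      (fun t => ‖x - z‖ ^ 2 + 2 * t * inner ℝ (x - z) a + t ^ 2 * ‖a‖ ^ 2)
      (2 * inner ℝ (x - z) a + 2 * t * ‖a‖ ^ 2) t := by
    intro t
    have := ((((hasDerivAt_id t).const_mul 2).mul_const (inner ℝ (x - z) a)).const_add
      (‖x - z‖ ^ 2)).add (((hasDerivAt_id t).pow 2).mul_const (‖a‖ ^ 2))
    refine this.congr_deriv ?_
    simp
  rw [h1, show deriv (fun t : ℝ =>
    ‖x - z‖ ^ 2 + 2 * t * inner ℝ (x - z) a + t ^ 2 * ‖a‖ ^ 2) = _ from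
      funext fun t => (h2 t).deriv]
  simp

/-- A function that is `C²` near a point agrees near that point with a global `C²` function. -/
theorem exists_contDiff_eventuallyEq [FiniteDimensional ℝ H] {f : H → ℝ} {x : H}
    (hf : ContDiffAt ℝ 2 f x) : ∃ g : H → ℝ, ContDiff ℝ 2 g ∧ g =ᶠ[𝓝 x] f := by
  have hev : ∀ᶠ y in 𝓝 x, ContDiffAt ℝ 2 f y := hf.eventually (by simp)
  obtain ⟨r, hr, hball⟩ := Metric.eventually_nhds_iff_ball.1 hev
  let χ : ContDiffBump x := ⟨r / 3, r / 2, by positivity, by linarith⟩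
  refine ⟨fun y => χ y * f y, ?_, ?_⟩
  · rw [contDiff_iff_contDiffAt]
    intro y
    by_cases hy : y ∈ ball x r
    · exact χ.contDiff.contDiffAt.mul (hball y hy)
    · have hy2 : y ∉ tsupport χ := by
        rw [χ.tsupport_eq]
        intro h
        apply hy
        rw [mem_closedBall] at h
        rw [mem_ball]
        change dist y x ≤ r / 2 at h
        linarith
      have : (fun y => χ y * f y) =ᶠ[𝓝 y] fun _ => 0 := by
        filter_upwards [notMem_tsupport_iff_eventuallyEq.1 hy2] with w hw
        rw [hw]; simp
      exact contDiffAt_const.congr_of_eventuallyEq this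
  · filter_upwards [χ.eventuallyEq_one] with y hy
    rw [hy]; simp

variable [CompleteSpace H]

theorem gradient_comp_real {f : H → ℝ} {G : ℝ → ℝ} {G' : ℝ} {x : H}
    (hf : DifferentiableAt ℝ f x) (hG : HasDerivAt G G' (f x)) :
    gradient (fun y => G (f y)) x = G' • gradient f x := by
  apply HasGradientAt.gradient
  rw [hasGradientAt_iff_hasFDerivAt]
  have := hG.comp_hasFDerivAt x hf.hasFDerivAt
  refine this.congr_fderiv ?_
  rw [map_smulₛₗ, toDual_gradient]; simp

theorem gradient_sub_real {f g : H → ℝ} {x : H}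
    (hf : DifferentiableAt ℝ f x) (hg : DifferentiableAt ℝ g x) :
    gradient (fun y => f y - g y) x = gradient f x - gradient g x := by
  apply HasGradientAt.gradient
  rw [hasGradientAt_iff_hasFDerivAt]
  refine (hf.hasFDerivAt.sub hg.hasFDerivAt).congr_fderiv ?_
  rw [map_sub, toDual_gradient, toDual_gradient]

theorem gradient_add_real {f g : H → ℝ} {x : H}
    (hf : DifferentiableAt ℝ f x) (hg : DifferentiableAt ℝ g x) :
    gradient (fun y => f y + g y) x = gradient f x + gradient g x := by
  apply HasGradientAt.gradient
  rw [hasGradientAt_iff_hasFDerivAt]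
  refine (hf.hasFDerivAt.add hg.hasFDerivAt).congr_fderiv ?_
  rw [map_add, toDual_gradient, toDual_gradient]

/-- A `C²` function touched from below by another one at a point: the gradients agree and the
Hessians are ordered. -/
theorem touching_below {f g : H → ℝ} {x : H} (hf : ContDiffAt ℝ 2 f x)
    (hg : ContDiffAt ℝ 2 g x) (h : IsLocalMin (fun y => g y - f y) x) :
    gradient f x = gradient g x ∧
    ∀ a, iteratedFDeriv ℝ 2 f x ![a, a] ≤ iteratedFDeriv ℝ 2 g x ![a, a] := by
  constructor
  · have h1 := gradient_sub_real (hg.differentiableAt (by simp)) (hf.differentiableAt (by simp))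
    have h2 : gradient (fun y => g y - f y) x = 0 := by
      rw [gradient, h.fderiv_eq_zero, map_zero]
    rw [h2] at h1
    exact (sub_eq_zero.1 h1.symm).symm
  · intro a
    have := h.iteratedFDeriv_two_nonneg (hg.sub hf) a
    rw [iteratedFDeriv_two_sub hg hf] at this
    linarith

theorem gradient_norm_sq (z x : H) :
    gradient (fun y => ‖y - z‖ ^ 2) x = (2 : ℝ) • (x - z) := by
  apply HasGradientAt.gradient
  rw [hasGradientAt_iff_hasFDerivAt]
  have := ((hasFDerivAt_id (𝕜 := ℝ) x).sub_const z).norm_sq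
  refine this.congr_fderiv ?_
  ext a
  simp

end Calculus

section Operators

variable {n : ℕ}

/-- The expanded `p`-Laplacian `|∇φ|^{p-4}(|∇φ|² Δφ + (p-2) Δ_∞φ)`. -/
noncomputable def pOp (p : ℝ) (φ : EuclideanSpace ℝ (Fin n) → ℝ)
    (x : EuclideanSpace ℝ (Fin n)) : ℝ :=
  ‖gradient φ x‖ ^ (p - 4) * (‖gradient φ x‖ ^ 2 * lapl φ x + (p - 2) * hessQ φ x)

theorem Filter.EventuallyEq.hessQ_eq {f g : EuclideanSpace ℝ (Fin n) → ℝ}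
    {x : EuclideanSpace ℝ (Fin n)} (h : f =ᶠ[𝓝 x] g) : hessQ f x = hessQ g x := by
  unfold hessQ
  rw [h.gradient_eq, (h.iteratedFDeriv ℝ 2).self_of_nhds]

theorem Filter.EventuallyEq.pOp_eq {f g : EuclideanSpace ℝ (Fin n) → ℝ}
    {x : EuclideanSpace ℝ (Fin n)} (p : ℝ) (h : f =ᶠ[𝓝 x] g) : pOp p f x = pOp p g x := by
  unfold pOp lapl
  rw [h.hessQ_eq, h.gradient_eq, (h.iteratedFDeriv ℝ 2).self_of_nhds]

theorem isLocalMin_sub_congr {s f g : EuclideanSpace ℝ (Fin n) → ℝ}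
    {x : EuclideanSpace ℝ (Fin n)} (h : g =ᶠ[𝓝 x] f) (hmin : IsLocalMin (fun y => s y - f y) x) :
    IsLocalMin (fun y => s y - g y) x := by
  have : (fun y => s y - g y) =ᶠ[𝓝 x] fun y => s y - f y := by
    filter_upwards [h] with y hy
    rw [hy]
  exact hmin.congr this.symm

theorem IsPSuper.of_contDiffAt {Ω : Set (EuclideanSpace ℝ (Fin n))} {p lam : ℝ}
    {s φ : EuclideanSpace ℝ (Fin n) → ℝ} {x : EuclideanSpace ℝ (Fin n)}
    (hs : IsPSuper Ω p lam s) (hx : x ∈ Ω) (hφ : ContDiffAt ℝ 2 φ x)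
    (hmin : IsLocalMin (fun y => s y - φ y) x) : lam * Real.exp (s x) ≤ -(pOp p φ x) := by
  obtain ⟨g, hg, hgφ⟩ := exists_contDiff_eventuallyEq hφ
  rw [← hgφ.pOp_eq]
  exact hs x hx g hg ((isLocalMin_sub_congr hgφ hmin).on Ω)

theorem IsInftySuper.of_contDiffAt {Ω : Set (EuclideanSpace ℝ (Fin n))} {Λ : ℝ}
    {s φ : EuclideanSpace ℝ (Fin n) → ℝ} {x : EuclideanSpace ℝ (Fin n)}
    (hs : IsInftySuper Ω Λ s) (hx : x ∈ Ω) (hφ : ContDiffAt ℝ 2 φ x)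
    (hmin : IsLocalMin (fun y => s y - φ y) x) :
    Λ * Real.exp (s x) ≤ ‖gradient φ x‖ ∧ hessQ φ x ≤ 0 := by
  obtain ⟨g, hg, hgφ⟩ := exists_contDiff_eventuallyEq hφ
  rw [← hgφ.gradient_eq, ← hgφ.hessQ_eq]
  have := hs x hx g hg ((isLocalMin_sub_congr hgφ hmin).on Ω)
  exact ⟨by linarith [this.1], by linarith [this.2]⟩

theorem ContDiff.continuous_gradient {φ : EuclideanSpace ℝ (Fin n) → ℝ} (h : ContDiff ℝ 2 φ) :
    Continuous (gradient φ) :=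
  (LinearIsometryEquiv.continuous _).comp (h.continuous_fderiv (by simp))

theorem ContDiff.continuous_hessian_apply {φ : EuclideanSpace ℝ (Fin n) → ℝ}
    {w : EuclideanSpace ℝ (Fin n) → EuclideanSpace ℝ (Fin n)} (h : ContDiff ℝ 2 φ)
    (hw : Continuous w) : Continuous fun x => iteratedFDeriv ℝ 2 φ x ![w x, w x] := by
  have h1 : Continuous (fderiv ℝ (fderiv ℝ φ)) :=
    (h.fderiv_right (m := 1) (by norm_num)).continuous_fderiv (by simp)
  have : (fun x => iteratedFDeriv ℝ 2 φ x ![w x, w x])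
      = fun x => fderiv ℝ (fderiv ℝ φ) x (w x) (w x) := by
    ext x
    rw [iteratedFDeriv_two_apply]
    simp
  rw [this]
  exact (h1.clm_apply hw).clm_apply hw

theorem ContDiff.continuous_hessQ {φ : EuclideanSpace ℝ (Fin n) → ℝ} (h : ContDiff ℝ 2 φ) :
    Continuous (hessQ φ) := h.continuous_hessian_apply h.continuous_gradient

theorem ContDiff.continuous_lapl {φ : EuclideanSpace ℝ (Fin n) → ℝ} (h : ContDiff ℝ 2 φ) :
    Continuous (lapl φ) :=
  continuous_finsetSum _ fun _ _ => h.continuous_hessian_apply continuous_const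

theorem ContDiff.continuous_pOp {φ : EuclideanSpace ℝ (Fin n) → ℝ} {p : ℝ} (hp : 4 < p)
    (h : ContDiff ℝ 2 φ) : Continuous (pOp p φ) := by
  have h1 := h.continuous_gradient.norm
  exact (h1.rpow_const fun x => Or.inr (by linarith)).mul
    (((h1.pow 2).mul h.continuous_lapl).add (continuous_const.mul h.continuous_hessQ))

theorem pOp_mono {f g : EuclideanSpace ℝ (Fin n) → ℝ} {x : EuclideanSpace ℝ (Fin n)} {p : ℝ}
    (hp : 2 ≤ p) (h1 : gradient f x = gradient g x)
    (h2 : ∀ a, iteratedFDeriv ℝ 2 f x ![a, a] ≤ iteratedFDeriv ℝ 2 g x ![a, a]) :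
    pOp p f x ≤ pOp p g x := by
  unfold pOp hessQ lapl
  rw [h1]
  have : 0 ≤ p - 2 := by linarith
  have := h2 (gradient g x)
  gcongr
  exact h2 _

theorem pOp_of_gradient_eq_zero {f : EuclideanSpace ℝ (Fin n) → ℝ} {x : EuclideanSpace ℝ (Fin n)}
    {p : ℝ} (hp : 4 < p) (h : gradient f x = 0) : pOp p f x = 0 := by
  unfold pOp
  rw [h, norm_zero, Real.zero_rpow (by linarith), zero_mul]

/-- Adding a quartic at a point changes neither the gradient nor the Hessian there. -/
theorem quartic_perturbation {φ : EuclideanSpace ℝ (Fin n) → ℝ} (h : ContDiff ℝ 2 φ)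
    (K c : ℝ) (z : EuclideanSpace ℝ (Fin n)) :
    ContDiff ℝ 2 (fun y => φ y + (K * (‖y - z‖ ^ 2) ^ 2 + c)) ∧
    gradient (fun y => φ y + (K * (‖y - z‖ ^ 2) ^ 2 + c)) z = gradient φ z ∧
    ∀ a, iteratedFDeriv ℝ 2 (fun y => φ y + (K * (‖y - z‖ ^ 2) ^ 2 + c)) z ![a, a]
      = iteratedFDeriv ℝ 2 φ z ![a, a] := by
  have h0 : ContDiff ℝ 2 (fun y : EuclideanSpace ℝ (Fin n) => ‖y - z‖ ^ 2) :=
    (contDiff_id.sub contDiff_const).norm_sq ℝ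
  have hq : ContDiff ℝ 2 (fun y : EuclideanSpace ℝ (Fin n) => K * (‖y - z‖ ^ 2) ^ 2 + c) :=
    (contDiff_const.mul (h0.pow 2)).add contDiff_const
  have hG : ∀ t : ℝ, HasDerivAt (fun t : ℝ => K * t ^ 2 + c) (2 * K * t) t := fun t => by
    refine ((((hasDerivAt_id t).pow 2).const_mul K).add_const c).congr_deriv ?_
    simp; ring
  have hG' : ∀ t : ℝ, HasDerivAt (fun t : ℝ => 2 * K * t) (2 * K) t := fun t => by
    simpa using (hasDerivAt_id t).const_mul (2 * K)
  refine ⟨h.add hq, ?_, fun a => ?_⟩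
  · rw [gradient_add_real (h.differentiable (by simp) z) (hq.differentiable (by simp) z),
      gradient_comp_real (f := fun y => ‖y - z‖ ^ 2) (G := fun t => K * t ^ 2 + c)
        (h0.differentiable (by simp) z) (hG _)]
    simp
  · rw [iteratedFDeriv_two_add h.contDiffAt hq.contDiffAt,
      iteratedFDeriv_two_comp (f := fun y => ‖y - z‖ ^ 2) (G := fun t => K * t ^ 2 + c)
        h0.contDiffAt (Eventually.of_forall hG) (hG' _),
      ← inner_gradient_left, gradient_norm_sq]
    simp

theorem pOp_const_mul {φ : EuclideanSpace ℝ (Fin n) → ℝ} {x : EuclideanSpace ℝ (Fin n)}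
    (h : ContDiffAt ℝ 2 φ x) {c : ℝ} (hc : 0 < c) (p : ℝ) :
    pOp p (fun y => c * φ y) x = c ^ (p - 1) * pOp p φ x := by
  have hG : ∀ t : ℝ, HasDerivAt (fun t : ℝ => c * t) c t := fun t => by
    simpa using (hasDerivAt_id t).const_mul c
  have h1 : gradient (fun y => c * φ y) x = c • gradient φ x :=
    gradient_comp_real (h.differentiableAt (by simp)) (hG _)
  have h2 : ∀ a, iteratedFDeriv ℝ 2 (fun y => c * φ y) x ![a, a]
      = c * iteratedFDeriv ℝ 2 φ x ![a, a] := fun a => by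
    have := iteratedFDeriv_two_comp h (Eventually.of_forall hG) (hasDerivAt_const (φ x) c) a
    simpa using this
  have h3 : ∀ a, iteratedFDeriv ℝ 2 φ x ![c • a, c • a]
      = c ^ 2 * iteratedFDeriv ℝ 2 φ x ![a, a] := fun a => by
    rw [iteratedFDeriv_two_apply, iteratedFDeriv_two_apply]
    simp; ring
  unfold pOp hessQ lapl
  rw [h1]
  simp only [h2, h3, ← Finset.mul_sum, norm_smul, Real.norm_of_nonneg hc.le]
  rw [Real.mul_rpow hc.le (norm_nonneg _),
    show c ^ (p - 1) = c ^ (p - 4) * c ^ 3 by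
      rw [← Real.rpow_natCast, ← Real.rpow_add hc]; congr 1; push_cast; ring]
  ring

/-- Derivatives of `C |x - z|^{2γ} + A` away from its centre. -/
theorem radial_derivatives (C A γ : ℝ) {z x : EuclideanSpace ℝ (Fin n)} (hx : x ≠ z) :
    ContDiffAt ℝ 2 (fun y => C * (‖y - z‖ ^ 2) ^ γ + A) x ∧
    ‖gradient (fun y => C * (‖y - z‖ ^ 2) ^ γ + A) x‖
      = 2 * |C * γ| * (‖x - z‖ ^ 2) ^ (γ - 1) * ‖x - z‖ ∧
    ∀ p, ‖gradient (fun y => C * (‖y - z‖ ^ 2) ^ γ + A) x‖ ^ 2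
        * lapl (fun y => C * (‖y - z‖ ^ 2) ^ γ + A) x
        + (p - 2) * hessQ (fun y => C * (‖y - z‖ ^ 2) ^ γ + A) x
      = ‖gradient (fun y => C * (‖y - z‖ ^ 2) ^ γ + A) x‖ ^ 2
        * (2 * C * γ * (‖x - z‖ ^ 2) ^ (γ - 1))
        * (n + 2 * (γ - 1) + (p - 2) * (2 * γ - 1)) := by
  have hpos : 0 < ‖x - z‖ := norm_pos_iff.2 (sub_ne_zero.2 hx)
  have hq : 0 < ‖x - z‖ ^ 2 := by positivity
  have h0 : ContDiff ℝ 2 (fun y : EuclideanSpace ℝ (Fin n) => ‖y - z‖ ^ 2) :=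
    (contDiff_id.sub contDiff_const).norm_sq ℝ
  have hG : ∀ t : ℝ, 0 < t → HasDerivAt (fun t : ℝ => C * t ^ γ + A)
      (C * γ * t ^ (γ - 1)) t := fun t ht => by
    refine (((Real.hasDerivAt_rpow_const (p := γ) (Or.inl ht.ne')).const_mul C).add_const
      A).congr_deriv ?_
    ring
  have hG' : HasDerivAt (fun t : ℝ => C * γ * t ^ (γ - 1))
      (C * γ * (γ - 1) * (‖x - z‖ ^ 2) ^ (γ - 2)) (‖x - z‖ ^ 2) := by
    refine ((Real.hasDerivAt_rpow_const (p := γ - 1) (Or.inl hq.ne')).const_mul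
      (C * γ)).congr_deriv ?_
    rw [show γ - 1 - 1 = γ - 2 by ring]; ring
  have hgrad : gradient (fun y => C * (‖y - z‖ ^ 2) ^ γ + A) x
      = (2 * (C * γ) * (‖x - z‖ ^ 2) ^ (γ - 1)) • (x - z) := by
    rw [gradient_comp_real (f := fun y => ‖y - z‖ ^ 2) (G := fun t => C * t ^ γ + A)
        (h0.differentiable (by simp) x) (hG _ hq), gradient_norm_sq, smul_smul]
    congr 1; ring
  have hhess : ∀ a, iteratedFDeriv ℝ 2 (fun y => C * (‖y - z‖ ^ 2) ^ γ + A) x ![a, a]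
      = 2 * (C * γ) * (‖x - z‖ ^ 2) ^ (γ - 1) * ‖a‖ ^ 2
        + 4 * (C * γ) * (γ - 1) * (‖x - z‖ ^ 2) ^ (γ - 2) * (inner ℝ (x - z) a) ^ 2 := by
    intro a
    have hev : ∀ᶠ t in 𝓝 (‖x - z‖ ^ 2), HasDerivAt (fun t : ℝ => C * t ^ γ + A)
        (C * γ * t ^ (γ - 1)) t := by
      filter_upwards [lt_mem_nhds hq] with t ht using hG t ht
    rw [iteratedFDeriv_two_comp (f := fun y => ‖y - z‖ ^ 2) (G := fun t => C * t ^ γ + A)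
      h0.contDiffAt hev hG', ← inner_gradient_left, gradient_norm_sq, hessian_norm_sq,
      inner_smul_left]
    simp
    ring
  have hnorm : ‖gradient (fun y => C * (‖y - z‖ ^ 2) ^ γ + A) x‖
      = 2 * |C * γ| * (‖x - z‖ ^ 2) ^ (γ - 1) * ‖x - z‖ := by
    rw [hgrad, norm_smul, Real.norm_eq_abs, abs_mul, abs_mul,
      abs_of_pos (Real.rpow_pos_of_pos hq _)]
    simp
  refine ⟨?_, hnorm, fun p => ?_⟩
  · exact (contDiffAt_const.mul (h0.contDiffAt.rpow_const_of_ne hq.ne')).add contDiffAt_const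
  · have hsplit : (‖x - z‖ ^ 2) ^ (γ - 1) = (‖x - z‖ ^ 2) ^ (γ - 2) * ‖x - z‖ ^ 2 := by
      rw [← Real.rpow_add_one hq.ne']; congr 1; ring
    have hsum : ∑ i : Fin n, (inner ℝ (x - z) (EuclideanSpace.single i (1 : ℝ))) ^ 2
        = ‖x - z‖ ^ 2 := by
      rw [EuclideanSpace.norm_sq_eq]
      refine Finset.sum_congr rfl fun i _ => ?_
      rw [EuclideanSpace.inner_single_right]
      simp
    have hlapl : lapl (fun y => C * (‖y - z‖ ^ 2) ^ γ + A) x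
        = 2 * (C * γ) * (‖x - z‖ ^ 2) ^ (γ - 1) * (n + 2 * (γ - 1)) := by
      unfold lapl
      simp only [hhess, Finset.sum_add_distrib, ← Finset.mul_sum, hsum]
      simp
      rw [hsplit]; ring
    have hQ : hessQ (fun y => C * (‖y - z‖ ^ 2) ^ γ + A) x
        = ‖gradient (fun y => C * (‖y - z‖ ^ 2) ^ γ + A) x‖ ^ 2
          * (2 * (C * γ) * (‖x - z‖ ^ 2) ^ (γ - 1) * (2 * γ - 1)) := by
      unfold hessQ
      rw [hhess, hnorm, hgrad, inner_smul_right, real_inner_self_eq_norm_sq, hsplit]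
      have : |C * γ| ^ 2 = (C * γ) ^ 2 := sq_abs _
      rw [show (2 * |C * γ| * ((‖x - z‖ ^ 2) ^ (γ - 2) * ‖x - z‖ ^ 2) * ‖x - z‖) ^ 2
        = 4 * |C * γ| ^ 2 * ((‖x - z‖ ^ 2) ^ (γ - 2) * ‖x - z‖ ^ 2) ^ 2 * ‖x - z‖ ^ 2 by ring,
        this]
      ring
    rw [hQ, hlapl]
    ring

end Operators

section Perron

variable {n : ℕ}

/-- Stability of local minima under perturbation, after subtracting a quartic. -/
theorem exists_perturbed_localMin {Ω : Set (EuclideanSpace ℝ (Fin n))} (hΩo : IsOpen Ω)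
    {v φ : EuclideanSpace ℝ (Fin n) → ℝ} (hφ : Continuous φ) {x₀ : EuclideanSpace ℝ (Fin n)}
    (hx₀ : x₀ ∈ Ω) (hmin : IsLocalMin (fun y => v y - φ y) x₀) {r : ℝ} (hr : 0 < r) :
    ∃ δ > 0, ∀ f : EuclideanSpace ℝ (Fin n) → ℝ, ContinuousOn f Ω →
      (∀ x ∈ Ω, v x - δ ≤ f x) → f x₀ ≤ v x₀ + δ →
      ∃ x₁ ∈ Ω, dist x₁ x₀ < r ∧
        IsLocalMin (fun y => f y - (φ y + ((-1) * (‖y - x₀‖ ^ 2) ^ 2 + 0))) x₁ := by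
  obtain ⟨ρ, hρ, hball⟩ := Metric.eventually_nhds_iff_ball.1
    ((hΩo.eventually_mem hx₀).and hmin)
  set ρ' := min (ρ / 2) (r / 2) with hρ'
  have hρ'0 : 0 < ρ' := by positivity
  have hρ'r : ρ' < r := by have := min_le_right (ρ / 2) (r / 2); linarith
  have hsub : closedBall x₀ ρ' ⊆ ball x₀ ρ := by
    apply closedBall_subset_ball
    have := min_le_left (ρ / 2) (r / 2); linarith
  refine ⟨ρ' ^ 4 / 4, by positivity, fun f hf hfv hfx => ?_⟩
  obtain ⟨x₁, hx₁, hx₁min⟩ := (isCompact_closedBall x₀ ρ').exists_isMinOn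
    ⟨x₀, mem_closedBall_self hρ'0.le⟩
    (f := fun y => f y - (φ y + ((-1) * (‖y - x₀‖ ^ 2) ^ 2 + 0)))
    ((hf.mono fun y hy => (hball y (hsub hy)).1).sub (by fun_prop))
  have hx₁Ω := hball x₁ (hsub hx₁)
  have h1 := hx₁min (mem_closedBall_self hρ'0.le)
  simp only [Set.mem_ofPred_eq, sub_self, norm_zero] at h1
  have h2 := hfv x₁ hx₁Ω.1
  have h3 := hx₁Ω.2
  have h4 : ‖x₁ - x₀‖ ^ 4 < ρ' ^ 4 := by
    have : 0 < ρ' ^ 4 := by positivity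
    nlinarith
  have h5 : dist x₁ x₀ < ρ' := by
    rw [dist_eq_norm]; exact lt_of_pow_lt_pow_left₀ 4 hρ'0.le h4
  exact ⟨x₁, hx₁Ω.1, h5.trans hρ'r, hx₁min.isLocalMin (closedBall_mem_nhds_of_mem h5)⟩

theorem nonneg_of_forall_not_isLocalMin {Ω : Set (EuclideanSpace ℝ (Fin n))} (hΩo : IsOpen Ω)
    (hΩb : Bornology.IsBounded Ω) {s : EuclideanSpace ℝ (Fin n) → ℝ}
    (hs : ContinuousOn s (closure Ω)) (hbd : ∀ x ∈ frontier Ω, s x = 0)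
    (h : ∀ x ∈ Ω, ¬ IsLocalMin s x) : ∀ x ∈ closure Ω, 0 ≤ s x := by
  intro x hx
  obtain ⟨y, hy, hymin⟩ := hΩb.isCompact_closure.exists_isMinOn ⟨x, hx⟩ hs
  by_cases hyΩ : y ∈ Ω
  · exact absurd (hymin.isLocalMin (mem_of_superset (hΩo.mem_nhds hyΩ) subset_closure)) (h y hyΩ)
  · have : y ∈ frontier Ω := by rw [hΩo.frontier_eq]; exact ⟨hy, hyΩ⟩
    have h1 := hymin hx
    simp only [Set.mem_ofPred_eq, hbd y this] at h1
    exact h1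

theorem IsPSuper.nonneg {Ω : Set (EuclideanSpace ℝ (Fin n))} (hΩo : IsOpen Ω)
    (hΩb : Bornology.IsBounded Ω) {p lam : ℝ} (hp : 4 < p) (hlam : 0 < lam)
    {s : EuclideanSpace ℝ (Fin n) → ℝ}
    (hs : ContinuousOn s (closure Ω)) (hbd : ∀ x ∈ frontier Ω, s x = 0)
    (h : IsPSuper Ω p lam s) : ∀ x ∈ closure Ω, 0 ≤ s x := by
  refine nonneg_of_forall_not_isLocalMin hΩo hΩb hs hbd fun x hx hmin => ?_
  have h1 := h.of_contDiffAt (φ := fun _ => 0) hx contDiffAt_const (by simpa using hmin)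
  rw [pOp_of_gradient_eq_zero hp (gradient_fun_const _ _)] at h1
  have : 0 < lam * Real.exp (s x) := by positivity
  linarith

theorem IsInftySuper.nonneg {Ω : Set (EuclideanSpace ℝ (Fin n))} (hΩo : IsOpen Ω)
    (hΩb : Bornology.IsBounded Ω) {Λ : ℝ} (hΛ : 0 < Λ)
    {s : EuclideanSpace ℝ (Fin n) → ℝ}
    (hs : ContinuousOn s (closure Ω)) (hbd : ∀ x ∈ frontier Ω, s x = 0)
    (h : IsInftySuper Ω Λ s) : ∀ x ∈ closure Ω, 0 ≤ s x := by
  refine nonneg_of_forall_not_isLocalMin hΩo hΩb hs hbd fun x hx hmin => ?_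
  have h1 := (h.of_contDiffAt (φ := fun _ => 0) hx contDiffAt_const (by simpa using hmin)).1
  rw [gradient_fun_const, norm_zero] at h1
  have : 0 < Λ * Real.exp (s x) := by positivity
  linarith

/-- `f` decreases away from any point at most like the Hölder cone of exponent `1/2`. -/
def HolderConeBound (Ω : Set (EuclideanSpace ℝ (Fin n))) (f : EuclideanSpace ℝ (Fin n) → ℝ) :
    Prop :=
  ∀ y r, 0 < r → closedBall y r ⊆ Ω → ∀ x ∈ closedBall y r,
    f y - f y * ((‖x - y‖ ^ 2) ^ (1 / 4 : ℝ) / (r ^ 2) ^ (1 / 4 : ℝ)) ≤ f x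

theorem IsPSuper.holderConeBound {Ω : Set (EuclideanSpace ℝ (Fin n))} {p lam : ℝ}
    (hpn : 2 * n + 2 ≤ p) (hlam : 0 < lam) {s : EuclideanSpace ℝ (Fin n) → ℝ}
    (hs : ContinuousOn s Ω) (hs0 : ∀ x ∈ Ω, 0 ≤ s x) (h : IsPSuper Ω p lam s) :
    HolderConeBound Ω s := by
  intro y r hr hball x hx
  have hyΩ : y ∈ Ω := hball (mem_closedBall_self hr.le)
  rcases (hs0 y hyΩ).eq_or_lt with hy0 | hy0
  · simpa [← hy0] using hs0 x (hball hx)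
  by_contra! hlt
  have hr4 : 0 < (r ^ 2) ^ (1 / 4 : ℝ) := by positivity
  set C : ℝ := -(s y / (r ^ 2) ^ (1 / 4 : ℝ)) with hC
  have hC0 : C < 0 := by rw [hC]; have := div_pos hy0 hr4; linarith
  have hψc : Continuous fun z : EuclideanSpace ℝ (Fin n) =>
      C * (‖z - y‖ ^ 2) ^ (1 / 4 : ℝ) + s y := by
    refine (continuous_const.mul (Continuous.rpow_const (by fun_prop) fun _ => ?_)).add
      continuous_const
    right; norm_num
  obtain ⟨x₁, hx₁, hmin⟩ := (isCompact_closedBall y r).exists_isMinOn ⟨x, hx⟩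
    (f := fun z => s z - (C * (‖z - y‖ ^ 2) ^ (1 / 4 : ℝ) + s y))
    ((hs.mono hball).sub hψc.continuousOn)
  have hneg : s x₁ - (C * (‖x₁ - y‖ ^ 2) ^ (1 / 4 : ℝ) + s y) < 0 := by
    have h1 := hmin hx
    simp only [Set.mem_ofPred_eq] at h1
    refine h1.trans_lt ?_
    have : C * (‖x - y‖ ^ 2) ^ (1 / 4 : ℝ)
        = - (s y * ((‖x - y‖ ^ 2) ^ (1 / 4 : ℝ) / (r ^ 2) ^ (1 / 4 : ℝ))) := by
      rw [hC]; ring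
    rw [this]; linarith
  have hne : x₁ ≠ y := by
    rintro rfl
    rw [sub_self, norm_zero, zero_pow two_ne_zero, Real.zero_rpow (by norm_num)] at hneg
    linarith
  have hlt : dist x₁ y < r := by
    refine lt_of_le_of_ne hx₁ fun heq => ?_
    rw [dist_eq_norm] at heq
    rw [heq, hC, neg_mul, div_mul_cancel₀ _ hr4.ne'] at hneg
    linarith [hs0 x₁ (hball hx₁)]
  obtain ⟨hd1, -, hd3⟩ := radial_derivatives C (s y) (1 / 4) hne
  have hsup := h.of_contDiffAt (hball hx₁) hd1
    (hmin.isLocalMin (closedBall_mem_nhds_of_mem hlt))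
  have hop : 0 ≤ pOp p (fun z => C * (‖z - y‖ ^ 2) ^ (1 / 4 : ℝ) + s y) x₁ := by
    unfold pOp
    rw [hd3]
    have h1 : 0 ≤ (‖x₁ - y‖ ^ 2) ^ ((1 / 4 : ℝ) - 1) := by positivity
    have h2 : 2 * C * (1 / 4) * (‖x₁ - y‖ ^ 2) ^ ((1 / 4 : ℝ) - 1) ≤ 0 := by nlinarith
    have h3 : (n : ℝ) + 2 * (1 / 4 - 1) + (p - 2) * (2 * (1 / 4) - 1) ≤ 0 := by linarith
    refine mul_nonneg (by positivity) ?_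
    rw [mul_assoc]
    exact mul_nonneg (by positivity) (mul_nonneg_of_nonpos_of_nonpos h2 h3)
  have : 0 < lam * Real.exp (s x₁) := by positivity
  linarith

theorem HolderConeBound.abs_sub_le {Ω : Set (EuclideanSpace ℝ (Fin n))}
    {f : EuclideanSpace ℝ (Fin n) → ℝ} (h : HolderConeBound Ω f) {M : ℝ}
    (hM : ∀ x ∈ Ω, f x ≤ M) {x₀ : EuclideanSpace ℝ (Fin n)} {r : ℝ} (hr : 0 < r)
    (hball : closedBall x₀ (2 * r) ⊆ Ω) {x : EuclideanSpace ℝ (Fin n)}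
    (hx : x ∈ closedBall x₀ r) :
    |f x - f x₀| ≤ M * ((‖x - x₀‖ ^ 2) ^ (1 / 4 : ℝ) / (r ^ 2) ^ (1 / 4 : ℝ)) := by
  have h1 := h x₀ r hr ((closedBall_subset_closedBall (by linarith)).trans hball) x hx
  have hxb : closedBall x r ⊆ Ω := by
    refine Subset.trans (closedBall_subset_closedBall' ?_) hball
    have : dist x x₀ ≤ r := hx
    linarith
  have h2 := h x r hr hxb x₀ (by rwa [mem_closedBall, dist_comm])
  rw [norm_sub_rev x₀ x] at h2
  have h3 := hM x (hxb (mem_closedBall_self hr.le))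
  have h4 := hM x₀ (hball (mem_closedBall_self (by linarith)))
  have h5 : 0 ≤ (‖x - x₀‖ ^ 2) ^ (1 / 4 : ℝ) / (r ^ 2) ^ (1 / 4 : ℝ) := by positivity
  rw [abs_le]
  constructor <;> nlinarith

/-- The minimum of a supersolution with a function that is a supersolution wherever it is the
smaller of the two. -/
theorem IsPSuper.min {Ω : Set (EuclideanSpace ℝ (Fin n))} (hΩo : IsOpen Ω) {p lam : ℝ}
    {s S : EuclideanSpace ℝ (Fin n) → ℝ} (h : IsPSuper Ω p lam s)
    (hS : ∀ x ∈ Ω, S x < s x → ∀ ψ : EuclideanSpace ℝ (Fin n) → ℝ, ContDiff ℝ 2 ψ →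
      IsLocalMin (fun y => S y - ψ y) x → lam * Real.exp (S x) ≤ -(pOp p ψ x)) :
    IsPSuper Ω p lam (fun x => min (s x) (S x)) := by
  intro x hx ψ hψ hmin
  have hmin' : IsLocalMin (fun y => Min.min (s y) (S y) - ψ y) x :=
    hmin.isLocalMin (hΩo.mem_nhds hx)
  rcases le_or_gt (s x) (S x) with hle | hlt
  · change lam * Real.exp (Min.min (s x) (S x)) ≤ -(pOp p ψ x)
    rw [min_eq_left hle]
    refine h.of_contDiffAt hx hψ.contDiffAt ?_
    filter_upwards [hmin'] with y hy
    rw [min_eq_left hle] at hy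
    linarith [min_le_left (s y) (S y)]
  · change lam * Real.exp (Min.min (s x) (S x)) ≤ -(pOp p ψ x)
    rw [min_eq_right hlt.le]
    refine hS x hx hlt ψ hψ ?_
    filter_upwards [hmin'] with y hy
    rw [min_eq_right hlt.le] at hy
    linarith [min_le_right (s y) (S y)]

/-- Continuous `p`-supersolutions vanishing on the boundary. -/
def PSuperClass (Ω : Set (EuclideanSpace ℝ (Fin n))) (p lam : ℝ) :
    Set (EuclideanSpace ℝ (Fin n) → ℝ) :=
  {s | ContinuousOn s (closure Ω) ∧ (∀ x ∈ frontier Ω, s x = 0) ∧ IsPSuper Ω p lam s}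

/-- The pointwise infimum of all continuous `p`-supersolutions vanishing on the boundary. -/
noncomputable def infPSuper (Ω : Set (EuclideanSpace ℝ (Fin n))) (p lam : ℝ)
    (x : EuclideanSpace ℝ (Fin n)) : ℝ :=
  sInf ((fun s : EuclideanSpace ℝ (Fin n) → ℝ => s x) '' PSuperClass Ω p lam)

theorem infPSuper_le {Ω : Set (EuclideanSpace ℝ (Fin n))} (hΩo : IsOpen Ω)
    (hΩb : Bornology.IsBounded Ω) {p lam : ℝ} (hp : 4 < p) (hlam : 0 < lam)
    {s : EuclideanSpace ℝ (Fin n) → ℝ} (hs : s ∈ PSuperClass Ω p lam) :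
    ∀ x ∈ closure Ω, infPSuper Ω p lam x ≤ s x := fun x hx =>
  csInf_le ⟨0, by rintro _ ⟨t, ht, rfl⟩; exact ht.2.2.nonneg hΩo hΩb hp hlam ht.1 ht.2.1 x hx⟩
    ⟨s, hs, rfl⟩

theorem le_infPSuper {Ω : Set (EuclideanSpace ℝ (Fin n))} {p lam c : ℝ}
    (hne : (PSuperClass Ω p lam).Nonempty) {x : EuclideanSpace ℝ (Fin n)}
    (h : ∀ s ∈ PSuperClass Ω p lam, c ≤ s x) : c ≤ infPSuper Ω p lam x :=
  le_csInf (hne.image _) (by rintro _ ⟨s, hs, rfl⟩; exact h s hs)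

theorem exists_lt_infPSuper_add {Ω : Set (EuclideanSpace ℝ (Fin n))} {p lam ε : ℝ}
    (hne : (PSuperClass Ω p lam).Nonempty) (x : EuclideanSpace ℝ (Fin n)) (hε : 0 < ε) :
    ∃ s ∈ PSuperClass Ω p lam, s x < infPSuper Ω p lam x + ε := by
  obtain ⟨_, ⟨s, hs, rfl⟩, h⟩ := exists_lt_of_csInf_lt
    (hne.image (fun s : EuclideanSpace ℝ (Fin n) → ℝ => s x))
    (lt_add_of_pos_right (infPSuper Ω p lam x) hε)
  exact ⟨s, hs, h⟩

theorem continuousOn_infPSuper {Ω : Set (EuclideanSpace ℝ (Fin n))} (hΩo : IsOpen Ω)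
    (hΩb : Bornology.IsBounded Ω) {p lam : ℝ} (hp : 4 < p) (hpn : 2 * n + 2 ≤ p)
    (hlam : 0 < lam) {u : EuclideanSpace ℝ (Fin n) → ℝ} (hu : u ∈ PSuperClass Ω p lam) :
    ContinuousOn (infPSuper Ω p lam) (closure Ω) := by
  have hne : (PSuperClass Ω p lam).Nonempty := ⟨u, hu⟩
  have h0 : ∀ x ∈ closure Ω, 0 ≤ infPSuper Ω p lam x := fun x hx =>
    le_infPSuper hne fun s hs => hs.2.2.nonneg hΩo hΩb hp hlam hs.1 hs.2.1 x hx
  have hcone : HolderConeBound Ω (infPSuper Ω p lam) := by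
    intro y r hr hball x hx
    have hyΩ : y ∈ Ω := hball (mem_closedBall_self hr.le)
    refine le_infPSuper hne fun s hs => ?_
    have h1 := (hs.2.2.holderConeBound hpn hlam (hs.1.mono subset_closure) fun z hz =>
      hs.2.2.nonneg hΩo hΩb hp hlam hs.1 hs.2.1 z (subset_closure hz)) y r hr hball x hx
    refine le_trans ?_ h1
    have h2 := infPSuper_le hΩo hΩb hp hlam hs y (subset_closure hyΩ)
    have h3 : (‖x - y‖ ^ 2) ^ (1 / 4 : ℝ) / (r ^ 2) ^ (1 / 4 : ℝ) ≤ 1 := by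
      apply div_le_one_of_le₀ _ (by positivity)
      have : ‖x - y‖ ≤ r := by rw [← dist_eq_norm]; exact hx
      gcongr
    nlinarith
  obtain ⟨M, hM⟩ := hΩb.isCompact_closure.bddAbove_image hu.1
  have hM' : ∀ x ∈ Ω, infPSuper Ω p lam x ≤ M := fun x hx =>
    (infPSuper_le hΩo hΩb hp hlam hu x (subset_closure hx)).trans
      (hM ⟨x, subset_closure hx, rfl⟩)
  intro x₀ hx₀
  by_cases hxΩ : x₀ ∈ Ω
  · apply ContinuousAt.continuousWithinAt
    obtain ⟨r, hr, hball⟩ := Metric.nhds_basis_closedBall.mem_iff.1 (hΩo.mem_nhds hxΩ)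
    have hev : ∀ᶠ x in 𝓝 x₀, ‖infPSuper Ω p lam x - infPSuper Ω p lam x₀‖
        ≤ M * ((‖x - x₀‖ ^ 2) ^ (1 / 4 : ℝ) / ((r / 2) ^ 2) ^ (1 / 4 : ℝ)) := by
      filter_upwards [closedBall_mem_nhds x₀ (half_pos hr)] with x hx
      exact hcone.abs_sub_le hM' (half_pos hr) (by rwa [mul_div_cancel₀ _ two_ne_zero]) hx
    have hlim : Tendsto (fun x => M * ((‖x - x₀‖ ^ 2) ^ (1 / 4 : ℝ) /
        ((r / 2) ^ 2) ^ (1 / 4 : ℝ))) (𝓝 x₀) (𝓝 0) := by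
      have : Continuous fun x => M * ((‖x - x₀‖ ^ 2) ^ (1 / 4 : ℝ) /
          ((r / 2) ^ 2) ^ (1 / 4 : ℝ)) := by
        refine continuous_const.mul (Continuous.div_const
          (Continuous.rpow_const (by fun_prop) fun _ => Or.inr (by norm_num)) _)
      have h := this.tendsto x₀
      simpa [Real.zero_rpow] using h
    exact tendsto_sub_nhds_zero_iff.1 (squeeze_zero_norm' hev hlim)
  · have hfr : x₀ ∈ frontier Ω := by rw [hΩo.frontier_eq]; exact ⟨hx₀, hxΩ⟩
    have hux := hu.1 x₀ hx₀
    have hW0 : infPSuper Ω p lam x₀ = 0 := le_antisymm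
      ((infPSuper_le hΩo hΩb hp hlam hu x₀ hx₀).trans_eq (hu.2.1 x₀ hfr)) (h0 x₀ hx₀)
    rw [ContinuousWithinAt, hu.2.1 x₀ hfr] at hux
    rw [ContinuousWithinAt, hW0]
    refine squeeze_zero' ?_ ?_ hux
    · filter_upwards [self_mem_nhdsWithin] with x hx using h0 x hx
    · filter_upwards [self_mem_nhdsWithin] with x hx using infPSuper_le hΩo hΩb hp hlam hu x hx

theorem isPSuper_infPSuper {Ω : Set (EuclideanSpace ℝ (Fin n))} (hΩo : IsOpen Ω)
    (hΩb : Bornology.IsBounded Ω) {p lam : ℝ} (hp : 4 < p) (hpn : 2 * n + 2 ≤ p)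
    (hlam : 0 < lam) {u : EuclideanSpace ℝ (Fin n) → ℝ} (hu : u ∈ PSuperClass Ω p lam) :
    IsPSuper Ω p lam (infPSuper Ω p lam) := by
  intro x₀ hx₀ φ hφ hmin
  set W := infPSuper Ω p lam with hW
  have hne : (PSuperClass Ω p lam).Nonempty := ⟨u, hu⟩
  have hcont : ContinuousAt W x₀ :=
    (continuousOn_infPSuper hΩo hΩb hp hpn hlam hu).continuousAt
      (mem_of_superset (hΩo.mem_nhds hx₀) subset_closure)
  obtain ⟨hq, hqg, hqh⟩ := quartic_perturbation hφ (-1) 0 x₀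
  set q := fun y => φ y + ((-1) * (‖y - x₀‖ ^ 2) ^ 2 + 0) with hqdef
  change lam * Real.exp (W x₀) ≤ -(pOp p φ x₀)
  have hqφ : pOp p φ x₀ ≤ pOp p q x₀ :=
    pOp_mono (by linarith) hqg.symm fun a => (hqh a).ge
  suffices lam * Real.exp (W x₀) ≤ -(pOp p q x₀) by linarith
  by_contra! hlt
  have hev : ∀ᶠ x in 𝓝 x₀, -(pOp p q x) < lam * Real.exp (W x) :=
    ContinuousAt.eventually_lt (hq.continuous_pOp hp).neg.continuousAt
      ((Real.continuous_exp.continuousAt.comp hcont).const_mul lam) hlt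
  obtain ⟨r, hr, hball⟩ := Metric.eventually_nhds_iff_ball.1 hev
  obtain ⟨δ, hδ, H⟩ := exists_perturbed_localMin hΩo hφ.continuous hx₀
    (hmin.isLocalMin (hΩo.mem_nhds hx₀)) hr
  obtain ⟨s, hs, hsx⟩ := exists_lt_infPSuper_add hne x₀ hδ
  have hWs := infPSuper_le hΩo hΩb hp hlam hs
  obtain ⟨x₁, hx₁, hx₁r, hx₁min⟩ := H s (hs.1.mono subset_closure)
    (fun x hx => by linarith [hWs x (subset_closure hx)]) hsx.le
  have h1 := hs.2.2.of_contDiffAt hx₁ hq.contDiffAt hx₁min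
  have h2 := hball x₁ hx₁r
  have h3 : lam * Real.exp (W x₁) ≤ lam * Real.exp (s x₁) := by
    have := hWs x₁ (subset_closure hx₁)
    gcongr
  linarith

theorem isPSub_infPSuper {Ω : Set (EuclideanSpace ℝ (Fin n))} (hΩo : IsOpen Ω)
    (hΩb : Bornology.IsBounded Ω) {p lam : ℝ} (hp : 4 < p) (hpn : 2 * n + 2 ≤ p)
    (hlam : 0 < lam) {u : EuclideanSpace ℝ (Fin n) → ℝ} (hu : u ∈ PSuperClass Ω p lam)
    (hbd : ∀ x ∈ frontier Ω, infPSuper Ω p lam x = 0) :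
    IsPSub Ω p lam (infPSuper Ω p lam) := by
  intro x₀ hx₀ φ hφ hmax
  have hWc := continuousOn_infPSuper hΩo hΩb hp hpn hlam hu
  have hWsuper := isPSuper_infPSuper hΩo hΩb hp hpn hlam hu
  have hWle := fun s hs => infPSuper_le (s := s) hΩo hΩb hp hlam hs
  set W := infPSuper Ω p lam with hW
  change -(pOp p φ x₀) ≤ lam * Real.exp (W x₀)
  by_contra! hlt
  obtain ⟨r, hr, hball⟩ := Metric.eventually_nhds_iff_ball.1
    ((hΩo.eventually_mem hx₀).and (hmax.isLocalMax (hΩo.mem_nhds hx₀)))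
  obtain ⟨B, hB⟩ := hΩb.isCompact_closure.bddAbove_image
    (hWc.sub hφ.continuous.continuousOn)
  have hB' : ∀ x ∈ closure Ω, W x - φ x ≤ B := fun x hx => hB ⟨x, hx, rfl⟩
  set c := W x₀ - φ x₀ with hc
  set K := (|B - c| + 1) / r ^ 4 with hK
  have hK0 : 0 < K := by positivity
  obtain ⟨hq, hqg, hqh⟩ := quartic_perturbation hφ K c x₀
  set q := fun y => φ y + (K * (‖y - x₀‖ ^ 2) ^ 2 + c) with hqdef
  have hqx₀ : q x₀ = W x₀ := by simp [hqdef, hc]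
  have hqφ : pOp p q x₀ ≤ pOp p φ x₀ := pOp_mono (by linarith) hqg fun a => (hqh a).le
  have hev : ∀ᶠ x in 𝓝 x₀, lam * Real.exp (q x) < -(pOp p q x) := by
    refine ContinuousAt.eventually_lt
      ((Real.continuous_exp.comp hq.continuous).const_mul lam).continuousAt
      (hq.continuous_pOp hp).neg.continuousAt ?_
    simp only [hqx₀]
    linarith
  obtain ⟨ρ, hρ, hball'⟩ := Metric.eventually_nhds_iff_ball.1 hev
  set r₂ := min r ρ with hr₂
  have hr₂0 : 0 < r₂ := lt_min hr hρ
  set δ := min (1 / 2) (K * r₂ ^ 4 / 2) with hδ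
  have hδ0 : 0 < δ := by positivity
  have hδ1 : δ ≤ 1 / 2 := min_le_left _ _
  have hδ2 : δ ≤ K * r₂ ^ 4 / 2 := min_le_right _ _
  have hfar : ∀ x ∈ closure Ω, q x - δ < W x → x ∈ ball x₀ r₂ := by
    intro x hx hlt'
    by_contra hx2
    rw [mem_ball, not_lt, dist_eq_norm] at hx2
    by_cases hxr : x ∈ ball x₀ r
    · have h1 : W x - φ x ≤ c := (hball x hxr).2
      have h2 : K * r₂ ^ 4 ≤ K * ‖x - x₀‖ ^ 4 := by gcongr
      have h3 : q x = φ x + (K * ‖x - x₀‖ ^ 4 + c) := by simp only [hqdef]; ring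
      have h4 : 0 < K * r₂ ^ 4 := by positivity
      linarith
    · rw [mem_ball, not_lt, dist_eq_norm] at hxr
      have h2 : K * r ^ 4 ≤ K * ‖x - x₀‖ ^ 4 := by gcongr
      have h3 : q x = φ x + (K * ‖x - x₀‖ ^ 4 + c) := by simp only [hqdef]; ring
      have h4 : K * r ^ 4 = |B - c| + 1 := div_mul_cancel₀ _ (by positivity)
      linarith [hB' x hx, le_abs_self (B - c)]
  have hT : (fun x => min (W x) (q x - δ)) ∈ PSuperClass Ω p lam := by
    refine ⟨hWc.inf (hq.continuous.sub continuous_const).continuousOn, fun x hx => ?_, ?_⟩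
    · have hx' : x ∈ closure Ω ∧ x ∉ Ω := by rwa [hΩo.frontier_eq] at hx
      have : W x ≤ q x - δ := by
        by_contra! h
        exact hx'.2 (hball x (ball_subset_ball (min_le_left _ _) (hfar x hx'.1 h))).1
      change min (W x) (q x - δ) = 0
      rw [min_eq_left this, hbd x hx]
    · refine hWsuper.min hΩo fun x hx hlt' ψ hψ hmin => ?_
      have hxb := hfar x (subset_closure hx) hlt'
      have h1 := hball' x (ball_subset_ball (min_le_right _ _) hxb)
      obtain ⟨hg, hh⟩ := touching_below hψ.contDiffAt hq.contDiffAt (x := x) (by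
        filter_upwards [hmin] with y hy
        linarith)
      have h2 := pOp_mono (p := p) (by linarith) hg hh
      have h3 : lam * Real.exp (q x - δ) ≤ lam * Real.exp (q x) := by
        gcongr; linarith
      linarith
  have := hWle _ hT x₀ (subset_closure hx₀)
  have h2 := min_le_right (W x₀) (q x₀ - δ)
  linarith

/-- A minimal continuous solution lies below every continuous supersolution. -/
theorem le_of_isPSuper_of_minimal {Ω : Set (EuclideanSpace ℝ (Fin n))} (hΩo : IsOpen Ω)
    (hΩb : Bornology.IsBounded Ω) {p lam : ℝ} (hp : 4 < p) (hpn : 2 * n + 2 ≤ p)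
    (hlam : 0 < lam) {u : EuclideanSpace ℝ (Fin n) → ℝ}
    (hu_min : ∀ w : EuclideanSpace ℝ (Fin n) → ℝ,
      ContinuousOn w (closure Ω) → (∀ x ∈ frontier Ω, w x = 0) →
      IsPSol Ω p lam w → ∀ x ∈ closure Ω, u x ≤ w x)
    {s : EuclideanSpace ℝ (Fin n) → ℝ} (hs : s ∈ PSuperClass Ω p lam) :
    ∀ x ∈ closure Ω, u x ≤ s x := by
  intro x hx
  have hbd : ∀ x ∈ frontier Ω, infPSuper Ω p lam x = 0 := fun x hx =>
    le_antisymm ((infPSuper_le hΩo hΩb hp hlam hs x (frontier_subset_closure hx)).trans_eq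
      (hs.2.1 x hx)) (le_infPSuper ⟨s, hs⟩ fun t ht => (ht.2.1 x hx).ge)
  exact (hu_min _ (continuousOn_infPSuper hΩo hΩb hp hpn hlam hs) hbd
    ⟨isPSuper_infPSuper hΩo hΩb hp hpn hlam hs, isPSub_infPSuper hΩo hΩb hp hpn hlam hs hbd⟩
    x hx).trans (infPSuper_le hΩo hΩb hp hlam hs x hx)

end Perron

section Scaling

variable {n : ℕ}

theorem mul_exp_eq_scaled {p lam : ℝ} (hp : 0 < p) (hlam : 0 < lam) (w : ℝ) :
    lam * Real.exp (p * w)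
      = p ^ (p - 1) * (p * (lam ^ (1 / p) / p * Real.exp w) ^ p) := by
  have h2 : p ^ (p - 1) * p = p ^ p := by
    rw [← Real.rpow_add_one hp.ne', sub_add_cancel]
  rw [← mul_assoc, h2, ← Real.mul_rpow hp.le (by positivity), ← mul_assoc,
    mul_div_cancel₀ _ hp.ne', Real.mul_rpow (by positivity) (by positivity), ← Real.rpow_mul
    hlam.le, one_div_mul_cancel hp.ne', Real.rpow_one, ← Real.exp_mul, mul_comm w p]

theorem le_neg_pOp_scaled_iff {p lam w : ℝ} (hp : 0 < p) (hlam : 0 < lam)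
    {φ : EuclideanSpace ℝ (Fin n) → ℝ} {x : EuclideanSpace ℝ (Fin n)}
    (hφ : ContDiffAt ℝ 2 φ x) :
    lam * Real.exp (p * w) ≤ -(pOp p (fun y => p * φ y) x) ↔
      p * (lam ^ (1 / p) / p * Real.exp w) ^ p ≤ -(pOp p φ x) := by
  rw [mul_exp_eq_scaled hp hlam, pOp_const_mul hφ hp, ← mul_neg]
  exact mul_le_mul_iff_right₀ (by positivity)

theorem neg_pOp_scaled_le_iff {p lam w : ℝ} (hp : 0 < p) (hlam : 0 < lam)
    {φ : EuclideanSpace ℝ (Fin n) → ℝ} {x : EuclideanSpace ℝ (Fin n)}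
    (hφ : ContDiffAt ℝ 2 φ x) :
    -(pOp p (fun y => p * φ y) x) ≤ lam * Real.exp (p * w) ↔
      -(pOp p φ x) ≤ p * (lam ^ (1 / p) / p * Real.exp w) ^ p := by
  rw [mul_exp_eq_scaled hp hlam, pOp_const_mul hφ hp, ← mul_neg]
  exact mul_le_mul_iff_right₀ (by positivity)

theorem tendsto_mul_rpow_sub {a : ℝ} (ha : 0 < a) (ha1 : a < 1) (s c : ℝ) :
    Tendsto (fun x : ℝ => x ^ s * a ^ (x - c)) atTop (𝓝 0) := by
  have h := (tendsto_rpow_mul_exp_neg_mul_atTop_nhds_zero s (-Real.log a)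
    (by have := Real.log_neg ha ha1; linarith)).const_mul (a ^ (-c))
  rw [mul_zero] at h
  refine h.congr fun x => ?_
  rw [neg_neg, mul_left_comm, Real.rpow_def_of_pos ha (-c), ← Real.exp_add,
    Real.rpow_def_of_pos ha]
  ring_nf

theorem eventually_rpow_sub_mul_lt {a b : ℝ} (ha : 0 < a) (hab : a < b) (c d C : ℝ)
    (hC : 0 ≤ C) : ∀ᶠ x : ℝ in atTop, x * (C * a ^ (x - c)) < b ^ (x - d) := by
  have hb : 0 < b := ha.trans hab
  have h := (tendsto_mul_rpow_sub (div_pos ha hb) ((div_lt_one hb).2 hab) 1 c).eventually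
    (gt_mem_nhds (show (0 : ℝ) < b ^ (c - d) / (C + 1) by positivity))
  filter_upwards [h, eventually_gt_atTop 0] with x hx hx0
  rw [Real.rpow_one, Real.div_rpow ha.le hb.le, lt_div_iff₀ (by positivity), mul_div_assoc',
    div_mul_eq_mul_div, div_lt_iff₀ (by positivity), ← Real.rpow_add hb] at hx
  have h1 : 0 < x * a ^ (x - c) := by positivity
  calc x * (C * a ^ (x - c)) ≤ x * a ^ (x - c) * (C + 1) := by nlinarith
    _ < _ := hx
    _ = _ := by ring_nf

theorem eventually_scaled_le {p ℓ : ℕ → ℝ} (hp : Tendsto p atTop atTop) {Λ Λ' B c : ℝ}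
    (hΛ : 0 < Λ) (hℓ0 : ∀ k, 0 < ℓ k) (hℓ : Tendsto ℓ atTop (𝓝 Λ)) (hΛ' : Λ < Λ') (hB : 0 < B)
    (hc : 0 < c) :
    ∀ᶠ k in atTop, ∀ N E : ℝ, 0 < E → E ≤ B → Λ' * E ≤ N →
      p k * (ℓ k * E) ^ p k ≤ N ^ (p k - 4) * (N ^ 2 * c) := by
  obtain ⟨μ, hμ, hμ'⟩ := exists_between hΛ'
  have hμ0 : 0 < μ := hΛ.trans hμ
  have hΛ'0 : 0 < Λ' := hΛ.trans hΛ'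
  have h := hp.eventually (eventually_rpow_sub_mul_lt hμ0 hμ' 2 2 ((μ * B) ^ 2 / c)
    (by positivity))
  filter_upwards [h, hℓ.eventually (gt_mem_nhds hμ), hp.eventually_gt_atTop 4]
    with k hk hℓk hpk N E hE hEB hN
  have hN0 : 0 < N := lt_of_lt_of_le (by positivity) hN
  have e1 : N ^ (p k - 4) * (N ^ 2 * c) = N ^ (p k - 2) * c := by
    rw [← mul_assoc, ← Real.rpow_natCast, ← Real.rpow_add hN0]; norm_num; left; ring_nf
  have hℓE := hℓ0 k
  have e2 : (ℓ k * E) ^ p k = (ℓ k * E) ^ (p k - 2) * (ℓ k * E) ^ 2 := by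
    rw [← Real.rpow_natCast, ← Real.rpow_add (by positivity)]; norm_num
  rw [e1, e2]
  have i1 : (ℓ k * E) ^ (p k - 2) ≤ (μ * E) ^ (p k - 2) :=
    Real.rpow_le_rpow (by positivity) (by gcongr) (by linarith)
  have i2 : (ℓ k * E) ^ 2 ≤ (μ * B) ^ 2 := by gcongr
  have i3 : (Λ' * E) ^ (p k - 2) ≤ N ^ (p k - 2) :=
    Real.rpow_le_rpow (by positivity) hN (by linarith)
  calc p k * ((ℓ k * E) ^ (p k - 2) * (ℓ k * E) ^ 2)
      ≤ p k * ((μ * E) ^ (p k - 2) * (μ * B) ^ 2) := by gcongr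
    _ = p k * ((μ * B) ^ 2 / c * μ ^ (p k - 2)) * (E ^ (p k - 2) * c) := by
        rw [Real.mul_rpow hμ0.le hE.le]; field_simp
    _ ≤ Λ' ^ (p k - 2) * (E ^ (p k - 2) * c) := by gcongr
    _ = (Λ' * E) ^ (p k - 2) * c := by rw [Real.mul_rpow hΛ'0.le hE.le]; ring
    _ ≤ _ := by gcongr

end Scaling

section Barrier

variable {n : ℕ}

/-- A power of the distance to the boundary, normalised to take values in `[0, m]` when the
distance is at most `R`. -/
noncomputable def boundaryBarrier (Ω : Set (EuclideanSpace ℝ (Fin n))) (R m : ℝ)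
    (x : EuclideanSpace ℝ (Fin n)) : ℝ :=
  m / (R ^ 2) ^ (m / 2) * (infDist x (frontier Ω) ^ 2) ^ (m / 2)

theorem continuous_boundaryBarrier (Ω : Set (EuclideanSpace ℝ (Fin n))) (R : ℝ) {m : ℝ}
    (hm : 0 < m) : Continuous (boundaryBarrier Ω R m) :=
  continuous_const.mul (Continuous.rpow_const ((continuous_infDist_pt _).pow 2)
    fun _ => Or.inr (by positivity))

theorem boundaryBarrier_le {Ω : Set (EuclideanSpace ℝ (Fin n))} {R m : ℝ} (hR0 : 0 < R)
    (hm : 0 < m) {x : EuclideanSpace ℝ (Fin n)} (hx : infDist x (frontier Ω) ≤ R) :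
    boundaryBarrier Ω R m x ≤ m := by
  have h0 : 0 ≤ infDist x (frontier Ω) := infDist_nonneg
  calc boundaryBarrier Ω R m x ≤ m / (R ^ 2) ^ (m / 2) * (R ^ 2) ^ (m / 2) := by
        unfold boundaryBarrier; gcongr
    _ = m := div_mul_cancel₀ _ (by positivity)

theorem boundaryBarrier_eq_zero {Ω : Set (EuclideanSpace ℝ (Fin n))} (R : ℝ) {m : ℝ}
    (hm : 0 < m) {x : EuclideanSpace ℝ (Fin n)} (hx : x ∈ frontier Ω) :
    boundaryBarrier Ω R m x = 0 := by
  rw [boundaryBarrier, infDist_zero_of_mem hx, zero_pow two_ne_zero,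
    Real.zero_rpow (by positivity), mul_zero]

theorem sq_rpow_half_sub_one {t : ℝ} (ht : 0 ≤ t) (m : ℝ) :
    (t ^ 2) ^ (m / 2 - 1) = t ^ (m - 2) := by
  rw [← Real.rpow_natCast, ← Real.rpow_mul ht]
  congr 1
  push_cast
  ring

theorem eventually_le_boundaryBarrier {Ω : Set (EuclideanSpace ℝ (Fin n))} (hΩo : IsOpen Ω)
    (hΩb : Bornology.IsBounded Ω) (hne : (frontier Ω).Nonempty) {R Λ m : ℝ} (hR0 : 0 < R)
    (hR : ∀ x ∈ Ω, infDist x (frontier Ω) ≤ R) (hΛ : 0 < Λ) (hm0 : 0 < m) (hm1 : m < 1)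
    (hm : Λ < m ^ 2 / R * Real.exp (-m))
    {p lam : ℕ → ℝ} (hp4 : ∀ k, 4 < p k) (hp : Tendsto p atTop atTop)
    (hlam : ∀ k, 0 < lam k)
    (hscale : Tendsto (fun k => lam k ^ (1 / p k) / p k) atTop (𝓝 Λ))
    {u : ℕ → EuclideanSpace ℝ (Fin n) → ℝ}
    (hu : ∀ᶠ k in atTop, ∀ s ∈ PSuperClass Ω (p k) (lam k), ∀ x ∈ closure Ω, u k x ≤ s x) :
    ∀ᶠ k in atTop, ∀ x ∈ closure Ω, u k x / p k ≤ boundaryBarrier Ω R m x := by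
  have hp0 : ∀ k, 0 < p k := fun k => by linarith [hp4 k]
  set C := m / (R ^ 2) ^ (m / 2) with hC
  have hC0 : 0 < C := by positivity
  have hc0 : 0 < C * m * R ^ (m - 2) := by positivity
  have hℓ0 : ∀ k, 0 < lam k ^ (1 / p k) / p k := fun k => by
    have := hp0 k; have := hlam k; positivity
  have hlarge : ∀ᶠ k in atTop, (n + 3) / (1 - m) ≤ p k := hp.eventually_ge_atTop _
  filter_upwards [hu, hlarge, eventually_scaled_le hp hΛ hℓ0 hscale hm (Real.exp_pos m) hc0]
    with k huk hlk hk
  have hkp := hp0 k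
  rw [div_le_iff₀ (by linarith)] at hlk
  suffices hS : (fun x => p k * boundaryBarrier Ω R m x) ∈ PSuperClass Ω (p k) (lam k) by
    intro x hx
    rw [div_le_iff₀' hkp]
    exact huk _ hS x hx
  refine ⟨(continuous_const.mul (continuous_boundaryBarrier Ω R hm0)).continuousOn,
    fun x hx => mul_eq_zero_of_right _ (boundaryBarrier_eq_zero R hm0 hx), ?_⟩
  intro x₀ hx₀ φ hφ hmin
  change lam k * Real.exp (p k * boundaryBarrier Ω R m x₀) ≤ -(pOp (p k) φ x₀)
  have hfc : IsCompact (frontier Ω) :=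
    hΩb.isCompact_closure.of_isClosed_subset isClosed_frontier frontier_subset_closure
  obtain ⟨z, hz, hzd⟩ := hfc.exists_infDist_eq_dist hne x₀
  have hxz : x₀ ≠ z := by
    rintro rfl
    rw [hΩo.frontier_eq] at hz
    exact hz.2 hx₀
  have hρ0 : 0 < ‖x₀ - z‖ := norm_pos_iff.2 (sub_ne_zero.2 hxz)
  have hρ : infDist x₀ (frontier Ω) = ‖x₀ - z‖ := by rw [hzd, dist_eq_norm]
  have hρR : ‖x₀ - z‖ ≤ R := hρ ▸ hR x₀ hx₀
  obtain ⟨hd1, hd2, hd3⟩ := radial_derivatives C 0 (m / 2) hxz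
  set ψ := fun y : EuclideanSpace ℝ (Fin n) => C * (‖y - z‖ ^ 2) ^ (m / 2) + 0 with hψ
  have hle : ∀ y, boundaryBarrier Ω R m y ≤ ψ y := fun y => by
    have h1 : infDist y (frontier Ω) ≤ ‖y - z‖ := by
      rw [← dist_eq_norm]; exact infDist_le_dist_of_mem hz
    have h0 : 0 ≤ infDist y (frontier Ω) := infDist_nonneg
    rw [hψ, boundaryBarrier]
    simp only [add_zero]
    gcongr
  have heq : boundaryBarrier Ω R m x₀ = ψ x₀ := by
    rw [hψ, boundaryBarrier, hρ]; simp only [add_zero, hC]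
  have htouch : IsLocalMin (fun y => p k * ψ y - φ y) x₀ := by
    have hmin' : IsLocalMin (fun y => p k * boundaryBarrier Ω R m y - φ y) x₀ :=
      hmin.isLocalMin (hΩo.mem_nhds hx₀)
    filter_upwards [hmin'] with y hy
    have := mul_le_mul_of_nonneg_left (hle y) hkp.le
    rw [← heq]
    linarith
  obtain ⟨hg, hh⟩ := touching_below hφ.contDiffAt (contDiffAt_const.mul hd1) htouch
  have hop := pOp_mono (p := p k) (by linarith [hp4 k]) hg hh
  suffices hmain : lam k * Real.exp (p k * boundaryBarrier Ω R m x₀)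
      ≤ -(pOp (p k) (fun y => p k * ψ y) x₀) by linarith
  rw [le_neg_pOp_scaled_iff hkp (hlam k) hd1]
  have hN : ‖gradient ψ x₀‖ = C * m * ‖x₀ - z‖ ^ (m - 1) := by
    rw [hd2, abs_of_pos (by positivity), sq_rpow_half_sub_one hρ0.le, mul_assoc,
      ← Real.rpow_add_one hρ0.ne']
    ring_nf
  have hNR : m ^ 2 / R ≤ ‖gradient ψ x₀‖ := by
    have h1 : R ^ (m - 1) ≤ ‖x₀ - z‖ ^ (m - 1) :=
      Real.rpow_le_rpow_of_nonpos hρ0 hρR (by linarith)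
    have h2 : m ^ 2 / R = C * m * R ^ (m - 1) := by
      rw [hC, ← Real.rpow_natCast R, ← Real.rpow_mul hR0.le, Real.rpow_sub_one hR0.ne']
      have : (0 : ℝ) < R ^ m := by positivity
      have e : ((2 : ℕ) : ℝ) * (m / 2) = m := by push_cast; ring
      rw [e]
      field_simp
    rw [hN, h2]
    gcongr
  have hb : boundaryBarrier Ω R m x₀ ≤ m := boundaryBarrier_le hR0 hm0 (hR x₀ hx₀)
  refine (hk ‖gradient ψ x₀‖ _ (Real.exp_pos _) (Real.exp_le_exp.2 hb) ?_).trans ?_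
  · refine le_trans ?_ hNR
    rw [mul_assoc, ← Real.exp_add]
    have : Real.exp (-m + boundaryBarrier Ω R m x₀) ≤ 1 := Real.exp_le_one_iff.2 (by linarith)
    exact mul_le_of_le_one_right (by positivity) this
  · unfold pOp
    rw [hd3, ← mul_neg]
    have h1 : R ^ (m - 2) ≤ (‖x₀ - z‖ ^ 2) ^ (m / 2 - 1) := by
      rw [sq_rpow_half_sub_one hρ0.le]
      exact Real.rpow_le_rpow_of_nonpos hρ0 hρR (by linarith)
    have h2 : C * m * R ^ (m - 2) ≤ 2 * C * (m / 2) * (‖x₀ - z‖ ^ 2) ^ (m / 2 - 1) := by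
      calc C * m * R ^ (m - 2) ≤ C * m * (‖x₀ - z‖ ^ 2) ^ (m / 2 - 1) := by gcongr
        _ = _ := by ring
    have h3 : 1 ≤ -((n : ℝ) + 2 * (m / 2 - 1) + (p k - 2) * (2 * (m / 2) - 1)) := by linarith
    rw [mul_assoc (‖gradient ψ x₀‖ ^ 2), ← mul_neg, ← mul_neg]
    refine mul_le_mul_of_nonneg_left (mul_le_mul_of_nonneg_left ?_ (by positivity))
      (by positivity)
    exact h2.trans (le_mul_of_one_le_right (by positivity) h3)

end Barrier

section Stability

variable {n : ℕ}

theorem eventually_exists_perturbed_localMin {Ω : Set (EuclideanSpace ℝ (Fin n))}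
    (hΩo : IsOpen Ω) {𝒰 : Filter ℕ} {F : ℕ → EuclideanSpace ℝ (Fin n) → ℝ}
    {f φ : EuclideanSpace ℝ (Fin n) → ℝ} (hF : ∀ k, ContinuousOn (F k) Ω)
    (hf : ContinuousOn f Ω) (hFf : TendstoUniformlyOn F f 𝒰 Ω) (hφ : Continuous φ)
    {x₀ : EuclideanSpace ℝ (Fin n)} (hx₀ : x₀ ∈ Ω)
    (hmin : IsLocalMin (fun y => f y - φ y) x₀)
    {P : EuclideanSpace ℝ (Fin n) × ℝ → Prop} (hP : ∀ᶠ z in 𝓝 (x₀, f x₀), P z) :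
    ∀ᶠ k in 𝒰, ∃ x₁ ∈ Ω, P (x₁, F k x₁) ∧
      IsLocalMin (fun y => F k y - (φ y + ((-1) * (‖y - x₀‖ ^ 2) ^ 2 + 0))) x₁ := by
  obtain ⟨r, hr, hball⟩ := Metric.eventually_nhds_iff_ball.1 hP
  have hfc : ∀ᶠ x in 𝓝 x₀, dist (f x) (f x₀) < r / 2 :=
    (hf.continuousAt (hΩo.mem_nhds hx₀)).eventually (ball_mem_nhds _ (half_pos hr))
  obtain ⟨ρ, hρ, hball'⟩ := Metric.eventually_nhds_iff_ball.1 hfc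
  obtain ⟨δ, hδ, H⟩ := exists_perturbed_localMin hΩo hφ hx₀ hmin (lt_min hr hρ)
  filter_upwards [Metric.tendstoUniformlyOn_iff.1 hFf δ hδ,
    Metric.tendstoUniformlyOn_iff.1 hFf (r / 2) (half_pos hr)] with k hk hk'
  have hk2 : ∀ x ∈ Ω, |f x - F k x| < δ := fun x hx => by
    rw [← Real.dist_eq]; exact hk x hx
  obtain ⟨x₁, hx₁, hd, hm⟩ := H (F k) (hF k)
    (fun x hx => by linarith [(abs_lt.1 (hk2 x hx)).2])
    (by linarith [(abs_lt.1 (hk2 x₀ hx₀)).1])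
  refine ⟨x₁, hx₁, hball _ ?_, hm⟩
  rw [mem_ball, Prod.dist_eq]
  refine max_lt (hd.trans_le (min_le_left _ _)) ?_
  have h1 := hk' x₁ hx₁
  have h2 := hball' x₁ (hd.trans_le (min_le_right _ _))
  rw [dist_comm] at h1
  calc dist (F k x₁) (f x₀) ≤ dist (F k x₁) (f x₁) + dist (f x₁) (f x₀) := dist_triangle _ _ _
    _ < r := by linarith

variable {Ω : Set (EuclideanSpace ℝ (Fin n))} {𝒰 : Filter ℕ} {Λ : ℝ} {p lam : ℕ → ℝ}
  {u : ℕ → EuclideanSpace ℝ (Fin n) → ℝ} {v : EuclideanSpace ℝ (Fin n) → ℝ}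

theorem IsPSuper.scaled {p lam : ℝ} {u φ : EuclideanSpace ℝ (Fin n) → ℝ} (hp : 0 < p)
    (hlam : 0 < lam) (hu : IsPSuper Ω p lam u) {x : EuclideanSpace ℝ (Fin n)} (hx : x ∈ Ω)
    (hφ : ContDiffAt ℝ 2 φ x) (hmin : IsLocalMin (fun y => u y / p - φ y) x) :
    p * (lam ^ (1 / p) / p * Real.exp (u x / p)) ^ p ≤ -(pOp p φ x) := by
  rw [← le_neg_pOp_scaled_iff hp hlam hφ, mul_div_cancel₀ _ hp.ne']
  refine hu.of_contDiffAt hx (contDiffAt_const.mul hφ) ?_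
  filter_upwards [hmin] with y hy
  have := mul_le_mul_of_nonneg_left hy hp.le
  rwa [mul_sub, mul_sub, mul_div_cancel₀ _ hp.ne', mul_div_cancel₀ _ hp.ne'] at this

theorem IsPSub.scaled {p lam : ℝ} {u φ : EuclideanSpace ℝ (Fin n) → ℝ} (hp : 0 < p)
    (hlam : 0 < lam) (hu : IsPSub Ω p lam u) {x : EuclideanSpace ℝ (Fin n)} (hx : x ∈ Ω)
    (hφ : ContDiff ℝ 2 φ) (hmax : IsLocalMax (fun y => u y / p - φ y) x) :
    -(pOp p φ x) ≤ p * (lam ^ (1 / p) / p * Real.exp (u x / p)) ^ p := by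
  rw [← neg_pOp_scaled_le_iff hp hlam hφ.contDiffAt, mul_div_cancel₀ _ hp.ne']
  refine hu x hx _ (contDiff_const.mul hφ) (IsLocalMax.on ?_ Ω)
  filter_upwards [hmax] with y hy
  have := mul_le_mul_of_nonneg_left hy hp.le
  rwa [mul_sub, mul_sub, mul_div_cancel₀ _ hp.ne', mul_div_cancel₀ _ hp.ne'] at this

theorem isInftySuper_of_tendstoUniformlyOn [𝒰.NeBot] (hΩo : IsOpen Ω)
    (hp0 : ∀ k, 0 < p k) (hp : Tendsto p 𝒰 atTop) (hlam : ∀ k, 0 < lam k)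
    (hscale : Tendsto (fun k => lam k ^ (1 / p k) / p k) 𝒰 (𝓝 Λ))
    (hu : ∀ k, ContinuousOn (u k) Ω) (hus : ∀ k, IsPSuper Ω (p k) (lam k) (u k))
    (hv : ContinuousOn v Ω) (huv : TendstoUniformlyOn (fun k x => u k x / p k) v 𝒰 Ω) :
    IsInftySuper Ω Λ v := by
  intro x₀ hx₀ φ hφ hmin
  have hmin' : IsLocalMin (fun y => v y - φ y) x₀ := hmin.isLocalMin (hΩo.mem_nhds hx₀)
  obtain ⟨hq, hqg, hqh⟩ := quartic_perturbation hφ (-1) 0 x₀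
  have happrox := fun {P : EuclideanSpace ℝ (Fin n) × ℝ → Prop} (hP : ∀ᶠ z in 𝓝 (x₀, v x₀), P z) =>
    eventually_exists_perturbed_localMin hΩo (fun k => (hu k).div_const (p k)) hv huv
      hφ.continuous hx₀ hmin' hP
  have hqQ : hessQ (fun y => φ y + ((-1) * (‖y - x₀‖ ^ 2) ^ 2 + 0)) x₀ = hessQ φ x₀ := by
    unfold hessQ; rw [hqg, hqh]
  set q := fun y => φ y + ((-1) * (‖y - x₀‖ ^ 2) ^ 2 + 0) with hqdef
  have hgc : Continuous fun z : EuclideanSpace ℝ (Fin n) × ℝ => ‖gradient q z.1‖ :=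
    (hq.continuous_gradient.comp continuous_fst).norm
  have hhc : Continuous fun z : EuclideanSpace ℝ (Fin n) × ℝ => hessQ q z.1 :=
    hq.continuous_hessQ.comp continuous_fst
  have hlc : Continuous fun z : EuclideanSpace ℝ (Fin n) × ℝ => lapl q z.1 :=
    hq.continuous_lapl.comp continuous_fst
  have hglc : Continuous fun z : EuclideanSpace ℝ (Fin n) × ℝ =>
      |‖gradient q z.1‖ ^ 2 * lapl q z.1| := ((hgc.pow 2).mul hlc).abs
  constructor
  · by_contra! hlt
    rw [sub_neg] at hlt
    obtain ⟨a, ha, ha'⟩ := exists_between hlt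
    obtain ⟨b, hab, hb⟩ := exists_between ha'
    have ha0 : 0 < a := (norm_nonneg _).trans_lt ha
    set C₁ := |lapl q x₀| + 1
    set C₂ := |hessQ q x₀| + 1
    have hnear : ∀ᶠ z in 𝓝 (x₀, v x₀), ‖gradient q z.1‖ < a ∧ |lapl q z.1| < C₁ ∧
        |hessQ q z.1| < C₂ := by
      refine (hgc.continuousAt.eventually (gt_mem_nhds ?_)).and
        ((hlc.abs.continuousAt.eventually (gt_mem_nhds ?_)).and
        (hhc.abs.continuousAt.eventually (gt_mem_nhds ?_)))
      · simpa [hqg] using ha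
      · exact lt_add_one _
      · exact lt_add_one _
    have hE : ∀ᶠ z : ℝ × ℝ in 𝓝 Λ ×ˢ 𝓝 (v x₀), b < z.1 * Real.exp z.2 := by
      rw [← nhds_prod_eq]
      have : Continuous fun z : ℝ × ℝ => z.1 * Real.exp z.2 := by fun_prop
      exact this.continuousAt.eventually (lt_mem_nhds hb)
    obtain ⟨P₁, hP₁, P₂, hP₂, hPP⟩ := Filter.eventually_prod_iff.1 hE
    have hnear₂ : ∀ᶠ z : EuclideanSpace ℝ (Fin n) × ℝ in 𝓝 (x₀, v x₀), P₂ z.2 :=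
      continuous_snd.continuousAt.eventually hP₂
    have hbig := hp.eventually (eventually_rpow_sub_mul_lt ha0 hab 4 0 (a ^ 2 * C₁ + C₂)
      (by positivity))
    obtain ⟨k, ⟨x₁, hx₁, ⟨⟨hg, hl, hh⟩, hP⟩, hm⟩, hk₁, hk₂, hk₃⟩ :=
      ((happrox (hnear.and hnear₂)).and ((hscale.eventually hP₁).and
        (hbig.and (hp.eventually_ge_atTop 4)))).exists
    have hs := (hus k).scaled (hp0 k) (hlam k) hx₁ hq.contDiffAt hm
    have h1 := hPP hk₁ hP
    simp only at h1 hl hh hg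
    have hpk := hp0 k
    have h2 : b ^ p k ≤ p k * (lam k ^ (1 / p k) / p k * Real.exp (u k x₁ / p k)) ^ p k := by
      have h3 : b ^ p k ≤ (lam k ^ (1 / p k) / p k * Real.exp (u k x₁ / p k)) ^ p k :=
        Real.rpow_le_rpow (ha0.trans hab).le h1.le hpk.le
      have h4 : 0 < b ^ p k := Real.rpow_pos_of_pos (ha0.trans hab) _
      nlinarith
    have h5 : -(pOp (p k) q x₁) ≤ p k * ((a ^ 2 * C₁ + C₂) * a ^ (p k - 4)) := by
      have h6 : ‖gradient q x₁‖ ^ 2 ≤ a ^ 2 := by gcongr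
      have h7 : -(‖gradient q x₁‖ ^ 2 * lapl q x₁) ≤ a ^ 2 * C₁ := by
        have := abs_lt.1 hl
        nlinarith [sq_nonneg ‖gradient q x₁‖, abs_nonneg (lapl q x₁)]
      have h8 : -((p k - 2) * hessQ q x₁) ≤ p k * C₂ := by
        have := abs_lt.1 hh
        nlinarith [abs_nonneg (hessQ q x₁)]
      have h9 : a ^ 2 * C₁ ≤ p k * (a ^ 2 * C₁) :=
        le_mul_of_one_le_left (by positivity) (by linarith)
      calc -(pOp (p k) q x₁)
          = ‖gradient q x₁‖ ^ (p k - 4) *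
            (-(‖gradient q x₁‖ ^ 2 * lapl q x₁) + -((p k - 2) * hessQ q x₁)) := by
            unfold pOp; ring
        _ ≤ ‖gradient q x₁‖ ^ (p k - 4) * (p k * (a ^ 2 * C₁ + C₂)) := by
            gcongr; linarith
        _ ≤ a ^ (p k - 4) * (p k * (a ^ 2 * C₁ + C₂)) := by
            gcongr
        _ = _ := by ring
    rw [sub_zero] at hk₂
    linarith
  · by_contra! hlt
    rw [← hqQ] at hlt
    obtain ⟨c, hc, hc'⟩ := exists_between (neg_neg_iff_pos.1 hlt)
    set C₁ := |‖gradient q x₀‖ ^ 2 * lapl q x₀| + 1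
    have hnear : ∀ᶠ z in 𝓝 (x₀, v x₀), |‖gradient q z.1‖ ^ 2 * lapl q z.1| < C₁ ∧
        c < hessQ q z.1 := by
      refine (hglc.continuousAt.eventually (gt_mem_nhds ?_)).and
        (hhc.continuousAt.eventually (lt_mem_nhds hc'))
      exact lt_add_one _
    obtain ⟨k, ⟨x₁, hx₁, ⟨hg, hh⟩, hm⟩, hk⟩ :=
      ((happrox hnear).and (hp.eventually_ge_atTop (C₁ / c + 2))).exists
    have hs := (hus k).scaled (hp0 k) (hlam k) hx₁ hq.contDiffAt hm
    have hpk := hp0 k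
    have hlk := hlam k
    have h1 : 0 < p k * (lam k ^ (1 / p k) / p k * Real.exp (u k x₁ / p k)) ^ p k := by
      positivity
    have h2 : C₁ ≤ (p k - 2) * c := by
      rw [← div_le_iff₀ hc]; linarith
    have h3 : 0 ≤ pOp (p k) q x₁ := by
      refine mul_nonneg (by positivity) ?_
      have h4 := abs_lt.1 hg
      have h5 : 0 ≤ C₁ := by positivity
      have h6 : 0 ≤ p k - 2 := by
        have : 0 ≤ C₁ / c := by positivity
        linarith
      simp only at h4 hh
      nlinarith
    linarith

theorem isInftySub_of_tendstoUniformlyOn [𝒰.NeBot] (hΩo : IsOpen Ω) (hΛ : 0 < Λ)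
    (hp0 : ∀ k, 0 < p k) (hp : Tendsto p 𝒰 atTop) (hlam : ∀ k, 0 < lam k)
    (hscale : Tendsto (fun k => lam k ^ (1 / p k) / p k) 𝒰 (𝓝 Λ))
    (hu : ∀ k, ContinuousOn (u k) Ω) (hus : ∀ k, IsPSub Ω (p k) (lam k) (u k))
    (hv : ContinuousOn v Ω) (huv : TendstoUniformlyOn (fun k x => u k x / p k) v 𝒰 Ω) :
    IsInftySub Ω Λ v := by
  intro x₀ hx₀ φ hφ hmax
  have hmin' : IsLocalMin (fun y => -v y - -φ y) x₀ := by
    filter_upwards [hmax.isLocalMax (hΩo.mem_nhds hx₀)] with y hy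
    linarith
  obtain ⟨hq, hqg, hqh⟩ := quartic_perturbation hφ 1 0 x₀
  have hneg : TendstoUniformlyOn (fun k x => -(u k x / p k)) (fun x => -v x) 𝒰 Ω :=
    huv.neg
  have happrox := fun {P : EuclideanSpace ℝ (Fin n) × ℝ → Prop} (hP : ∀ᶠ z in 𝓝 (x₀, -v x₀), P z) =>
    eventually_exists_perturbed_localMin (F := fun k x => -(u k x / p k)) (f := fun x => -v x)
      (φ := fun x => -φ x) hΩo (fun k => ((hu k).div_const (p k)).neg) hv.neg hneg
      hφ.continuous.neg hx₀ hmin' hP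
  have hqQ : hessQ (fun y => φ y + (1 * (‖y - x₀‖ ^ 2) ^ 2 + 0)) x₀ = hessQ φ x₀ := by
    unfold hessQ; rw [hqg, hqh]
  set q := fun y => φ y + (1 * (‖y - x₀‖ ^ 2) ^ 2 + 0) with hqdef
  have hgc : Continuous fun z : EuclideanSpace ℝ (Fin n) × ℝ => ‖gradient q z.1‖ :=
    (hq.continuous_gradient.comp continuous_fst).norm
  have hhc : Continuous fun z : EuclideanSpace ℝ (Fin n) × ℝ => hessQ q z.1 :=
    hq.continuous_hessQ.comp continuous_fst
  have hlc : Continuous fun z : EuclideanSpace ℝ (Fin n) × ℝ => lapl q z.1 :=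
    hq.continuous_lapl.comp continuous_fst
  have hglc : Continuous fun z : EuclideanSpace ℝ (Fin n) × ℝ =>
      |‖gradient q z.1‖ ^ 2 * lapl q z.1| := ((hgc.pow 2).mul hlc).abs
  by_contra! hlt
  obtain ⟨hlt₁, hlt₂⟩ := lt_min_iff.1 hlt
  rw [sub_pos] at hlt₁
  rw [← hqQ] at hlt₂
  obtain ⟨a, ha, ha'⟩ := exists_between hlt₁
  obtain ⟨b, hab, hb⟩ := exists_between ha'
  obtain ⟨c, hc, hc'⟩ := exists_between hlt₂
  have ha0 : 0 < a := lt_trans (by positivity) ha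
  set C₁ := |‖gradient q x₀‖ ^ 2 * lapl q x₀| + 1
  have hnear : ∀ᶠ z in 𝓝 (x₀, -v x₀), b < ‖gradient q z.1‖ ∧
      |‖gradient q z.1‖ ^ 2 * lapl q z.1| < C₁ ∧ c < -hessQ q z.1 := by
    refine (hgc.continuousAt.eventually (lt_mem_nhds ?_)).and
      ((hglc.continuousAt.eventually (gt_mem_nhds ?_)).and
        (hhc.neg.continuousAt.eventually (lt_mem_nhds hc')))
    · simpa [hqg] using hb
    · exact lt_add_one _
  have hE : ∀ᶠ z : ℝ × ℝ in 𝓝 Λ ×ˢ 𝓝 (-v x₀), z.1 * Real.exp (-z.2) < a := by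
    rw [← nhds_prod_eq]
    have : Continuous fun z : ℝ × ℝ => z.1 * Real.exp (-z.2) := by fun_prop
    exact this.continuousAt.eventually (gt_mem_nhds (by simpa using ha))
  obtain ⟨P₁, hP₁, P₂, hP₂, hPP⟩ := Filter.eventually_prod_iff.1 hE
  have hnear₂ : ∀ᶠ z : EuclideanSpace ℝ (Fin n) × ℝ in 𝓝 (x₀, -v x₀), P₂ z.2 :=
    continuous_snd.continuousAt.eventually hP₂
  have hbig := hp.eventually (eventually_rpow_sub_mul_lt ha0 hab 0 4 1 zero_le_one)
  obtain ⟨k, ⟨x₁, hx₁, ⟨⟨hg, hl, hh⟩, hP⟩, hm⟩, hk₁, hk₂, hk₃, hk₄⟩ :=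
    ((happrox (hnear.and hnear₂)).and ((hscale.eventually hP₁).and
      (hbig.and ((hp.eventually_ge_atTop 4).and
        (hp.eventually_ge_atTop ((C₁ + 1) / c + 2)))))).exists
  have hs := (hus k).scaled (hp0 k) (hlam k) hx₁ hq (by
    filter_upwards [hm] with y hy
    simp only [hqdef]
    linarith)
  have h1 := hPP hk₁ hP
  simp only [neg_neg] at h1 hl hh hg
  have hpk := hp0 k
  have hlk := hlam k
  have h2 : p k * (lam k ^ (1 / p k) / p k * Real.exp (u k x₁ / p k)) ^ p k
      ≤ p k * a ^ p k :=
    mul_le_mul_of_nonneg_left (Real.rpow_le_rpow (by positivity) h1.le hpk.le) hpk.le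
  have h3 : C₁ + 1 ≤ (p k - 2) * c := by
    rw [← div_le_iff₀ hc]; linarith
  have h4 : b ^ (p k - 4) ≤ -(pOp (p k) q x₁) := by
    have h5 : 1 ≤ -(‖gradient q x₁‖ ^ 2 * lapl q x₁ + (p k - 2) * hessQ q x₁) := by
      have := abs_lt.1 hl
      nlinarith
    have h6 : b ^ (p k - 4) ≤ ‖gradient q x₁‖ ^ (p k - 4) :=
      Real.rpow_le_rpow (ha0.trans hab).le hg.le (by linarith)
    unfold pOp
    rw [← mul_neg]
    exact h6.trans (le_mul_of_one_le_right (by positivity) h5)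
  rw [sub_zero, one_mul] at hk₂
  linarith

end Stability

section InfConvolution

variable {n : ℕ}

/-- The infimal convolution of `s` over `K` with the paraboloid `a‖·‖²`. -/
noncomputable def infConv (K : Set (EuclideanSpace ℝ (Fin n)))
    (s : EuclideanSpace ℝ (Fin n) → ℝ) (a : ℝ) (x : EuclideanSpace ℝ (Fin n)) : ℝ :=
  sInf ((fun y : K => s y + a * ‖x - y‖ ^ 2) '' univ)

variable {K Ω : Set (EuclideanSpace ℝ (Fin n))} {s : EuclideanSpace ℝ (Fin n) → ℝ} {a : ℝ}

theorem continuous_infConv (hK : IsCompact K) (hs : ContinuousOn s K) :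
    Continuous (infConv K s a) := by
  have : CompactSpace K := isCompact_iff_compactSpace.1 hK
  refine isCompact_univ.continuous_sInf
    (f := fun (x : EuclideanSpace ℝ (Fin n)) (y : K) => s y + a * ‖x - y‖ ^ 2) ?_
  have h1 : Continuous fun y : K => s y := hs.domRestrict
  exact (h1.comp continuous_snd).add (by fun_prop)

theorem infConv_attained (hK : IsCompact K) (hne : K.Nonempty) (hs : ContinuousOn s K)
    (x : EuclideanSpace ℝ (Fin n)) :
    ∃ y ∈ K, infConv K s a x = s y + a * ‖x - y‖ ^ 2 ∧
      ∀ z ∈ K, infConv K s a x ≤ s z + a * ‖x - z‖ ^ 2 := by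
  have : CompactSpace K := isCompact_iff_compactSpace.1 hK
  have : Nonempty K := hne.to_subtype
  have h1 : Continuous fun y : K => s y := hs.domRestrict
  obtain ⟨y, -, hy, hmin⟩ := isCompact_univ.exists_sInf_image_eq_and_le univ_nonempty
    (f := fun y : K => s y + a * ‖x - y‖ ^ 2) (h1.add (by fun_prop)).continuousOn
  exact ⟨y, y.2, hy, fun z hz => hy.trans_le (hmin ⟨z, hz⟩ (mem_univ _))⟩

theorem infConv_le (hK : IsCompact K) (hs : ContinuousOn s K) (x : EuclideanSpace ℝ (Fin n))
    {z : EuclideanSpace ℝ (Fin n)} (hz : z ∈ K) :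
    infConv K s a x ≤ s z + a * ‖x - z‖ ^ 2 := by
  obtain ⟨-, -, -, h⟩ := infConv_attained (a := a) hK ⟨z, hz⟩ hs x
  exact h z hz

theorem infConv_le_self (hK : IsCompact K) (hs : ContinuousOn s K)
    {x : EuclideanSpace ℝ (Fin n)} (hx : x ∈ K) : infConv K s a x ≤ s x := by
  simpa using infConv_le (a := a) hK hs x hx

theorem infConv_nonneg (hK : IsCompact K) (hne : K.Nonempty) (hs : ContinuousOn s K)
    (hs0 : ∀ x ∈ K, 0 ≤ s x) (ha : 0 ≤ a) (x : EuclideanSpace ℝ (Fin n)) :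
    0 ≤ infConv K s a x := by
  obtain ⟨y, hy, h, -⟩ := infConv_attained (a := a) hK hne hs x
  rw [h]
  have := hs0 y hy
  positivity

theorem gradient_comp_add_right (f : EuclideanSpace ℝ (Fin n) → ℝ)
    (x d : EuclideanSpace ℝ (Fin n)) :
    gradient (fun y => f (y + d)) x = gradient f (x + d) := by
  unfold gradient; rw [fderiv_comp_add_right]

theorem hessQ_comp_add_right (f : EuclideanSpace ℝ (Fin n) → ℝ)
    (x d : EuclideanSpace ℝ (Fin n)) :
    hessQ (fun y => f (y + d)) x = hessQ f (x + d) := by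
  unfold hessQ; rw [gradient_comp_add_right, iteratedFDeriv_comp_add_right]

/-- First and second order information at a point where a test function touches an infimal
convolution of an `∞`-supersolution from below. -/
theorem IsInftySuper.of_touching_infConv (hΩo : IsOpen Ω) (hK : IsCompact K)
    (hΩK : Ω ⊆ K) (hs : ContinuousOn s K) {Λ : ℝ} (h : IsInftySuper Ω Λ s)
    {Φ : EuclideanSpace ℝ (Fin n) → ℝ} {x₀ y₀ : EuclideanSpace ℝ (Fin n)}
    (hΦ : ContDiffAt ℝ 2 Φ x₀) (hmin : IsLocalMin (fun y => infConv K s a y - Φ y) x₀)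
    (hy₀ : y₀ ∈ Ω) (hy : infConv K s a x₀ = s y₀ + a * ‖x₀ - y₀‖ ^ 2) :
    Λ * Real.exp (s y₀) ≤ ‖gradient Φ x₀‖ ∧ hessQ Φ x₀ ≤ 0 ∧
      ∀ b, iteratedFDeriv ℝ 2 Φ x₀ ![b, b] ≤ 2 * a * ‖b‖ ^ 2 := by
  have hd : y₀ + (x₀ - y₀) = x₀ := add_sub_cancel _ _
  have hΦ' : ContDiffAt ℝ 2 (fun y => Φ (y + (x₀ - y₀))) y₀ := by
    refine ContDiffAt.comp (g := Φ) y₀ (by rwa [hd]) (contDiffAt_id.add contDiffAt_const)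
  have hmin' : IsLocalMin (fun y => s y - Φ (y + (x₀ - y₀))) y₀ := by
    have ht : Tendsto (fun y => y + (x₀ - y₀)) (𝓝 y₀) (𝓝 x₀) := by
      have : Continuous fun y => y + (x₀ - y₀) := by fun_prop
      simpa using this.tendsto y₀
    filter_upwards [ht.eventually hmin, hΩo.mem_nhds hy₀] with y h1 h2
    have h3 := infConv_le (a := a) hK hs (y + (x₀ - y₀)) (hΩK h2)
    rw [add_sub_cancel_left] at h3
    rw [hd]
    linarith
  have h1 := h.of_contDiffAt hy₀ hΦ' hmin'
  rw [gradient_comp_add_right, hessQ_comp_add_right, hd] at h1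
  refine ⟨h1.1, h1.2, fun b => ?_⟩
  have h0 : ContDiff ℝ 2 (fun y : EuclideanSpace ℝ (Fin n) => ‖y - y₀‖ ^ 2) :=
    (contDiff_id.sub contDiff_const).norm_sq ℝ
  have hG : ∀ t : ℝ, HasDerivAt (fun t : ℝ => a * t) a t := fun t => by
    simpa using (hasDerivAt_id t).const_mul a
  have h2 := (touching_below hΦ (contDiffAt_const.mul h0.contDiffAt)
    (g := fun y => a * ‖y - y₀‖ ^ 2) (by
      filter_upwards [hmin] with y h1
      have h3 := infConv_le (a := a) hK hs y (hΩK hy₀)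
      linarith)).2 b
  refine h2.trans_eq ?_
  rw [iteratedFDeriv_two_comp (f := fun y => ‖y - y₀‖ ^ 2) (G := fun t => a * t) h0.contDiffAt
    (Eventually.of_forall hG) (hasDerivAt_const _ a), hessian_norm_sq]
  ring

/-- Effect on first and second derivatives of the convex change of variables
`t ↦ (exp (κ (t + c)) - 1) / (κ A)`. -/
theorem derivatives_exp_comp {φ : EuclideanSpace ℝ (Fin n) → ℝ} {x : EuclideanSpace ℝ (Fin n)}
    (hφ : ContDiffAt ℝ 2 φ x) {κ A : ℝ} (hκ : 0 < κ) (hA : 0 < A) (c : ℝ) :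
    ContDiffAt ℝ 2 (fun y => (Real.exp (κ * (φ y + c)) - 1) / (κ * A)) x ∧
    ‖gradient (fun y => (Real.exp (κ * (φ y + c)) - 1) / (κ * A)) x‖
      = Real.exp (κ * (φ x + c)) / A * ‖gradient φ x‖ ∧
    hessQ (fun y => (Real.exp (κ * (φ y + c)) - 1) / (κ * A)) x
      = (Real.exp (κ * (φ x + c)) / A) ^ 3 * (hessQ φ x + κ * ‖gradient φ x‖ ^ 4) ∧
    ∀ b, Real.exp (κ * (φ x + c)) / A * iteratedFDeriv ℝ 2 φ x ![b, b] ≤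
      iteratedFDeriv ℝ 2 (fun y => (Real.exp (κ * (φ y + c)) - 1) / (κ * A)) x ![b, b] := by
  have hE : ∀ t : ℝ, HasDerivAt (fun t : ℝ => Real.exp (κ * (t + c)))
      (κ * Real.exp (κ * (t + c))) t := fun t => by
    have h1 : HasDerivAt (fun t : ℝ => κ * (t + c)) κ t := by
      simpa using ((hasDerivAt_id t).add_const c).const_mul κ
    simpa [mul_comm] using h1.exp
  have hG : ∀ t : ℝ, HasDerivAt (fun t : ℝ => (Real.exp (κ * (t + c)) - 1) / (κ * A))
      (Real.exp (κ * (t + c)) / A) t := fun t => by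
    refine (((hE t).sub_const 1).div_const (κ * A)).congr_deriv ?_
    field_simp
  have hG' : ∀ t : ℝ, HasDerivAt (fun t : ℝ => Real.exp (κ * (t + c)) / A)
      (κ * (Real.exp (κ * (t + c)) / A)) t := fun t => by
    refine ((hE t).div_const A).congr_deriv ?_
    ring
  have hgrad := gradient_comp_real (hφ.differentiableAt (by simp)) (hG (φ x))
  have hhess := iteratedFDeriv_two_comp hφ (Eventually.of_forall hG) (hG' (φ x))
  have hg : 0 < Real.exp (κ * (φ x + c)) / A := by positivity
  refine ⟨((contDiffAt_const.mul (hφ.add contDiffAt_const)).exp.sub contDiffAt_const).div_const _,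
    ?_, ?_, fun b => ?_⟩
  · rw [hgrad, norm_smul, Real.norm_of_nonneg hg.le]
  · have h3 : ∀ (d : ℝ) b, iteratedFDeriv ℝ 2 φ x ![d • b, d • b]
        = d ^ 2 * iteratedFDeriv ℝ 2 φ x ![b, b] := fun d b => by
      rw [iteratedFDeriv_two_apply, iteratedFDeriv_two_apply]
      simp; ring
    unfold hessQ
    rw [hgrad, hhess, h3, ← inner_gradient_left, inner_smul_right, real_inner_self_eq_norm_sq]
    ring
  · rw [hhess]
    have : 0 ≤ κ * (Real.exp (κ * (φ x + c)) / A) * (fderiv ℝ φ x b) ^ 2 := by positivity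
    linarith

end InfConvolution

section UpperBound

variable {n : ℕ} {K Ω : Set (EuclideanSpace ℝ (Fin n))} {s : EuclideanSpace ℝ (Fin n) → ℝ}

theorem lapl_le {φ : EuclideanSpace ℝ (Fin n) → ℝ} {x : EuclideanSpace ℝ (Fin n)} {C : ℝ}
    (h : ∀ b, iteratedFDeriv ℝ 2 φ x ![b, b] ≤ C * ‖b‖ ^ 2) : lapl φ x ≤ n * C := by
  unfold lapl
  refine (Finset.sum_le_card_nsmul _ _ C fun i _ => ?_).trans_eq (by simp)
  simpa using h (EuclideanSpace.single i 1)

/-- The concave change of variables `s ↦ κ⁻¹ log (1 + κ A s)`. -/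
noncomputable def logTransform (κ A t : ℝ) : ℝ := Real.log (1 + κ * A * t) / κ

theorem exp_logTransform {κ A t : ℝ} (hκ : 0 < κ) (hA : 0 < A) (ht : 0 ≤ t) :
    Real.exp (κ * logTransform κ A t) = 1 + κ * A * t := by
  unfold logTransform
  rw [mul_div_cancel₀ _ hκ.ne', Real.exp_log (by positivity)]

theorem logTransform_nonneg {κ A t : ℝ} (hκ : 0 < κ) (hA : 0 < A) (ht : 0 ≤ t) :
    0 ≤ logTransform κ A t :=
  div_nonneg (Real.log_nonneg (by have : 0 ≤ κ * A * t := by positivity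
                                  linarith)) hκ.le

theorem logTransform_le {κ A t : ℝ} (hκ : 0 < κ) (hA : 0 < A) (ht : 0 ≤ t) :
    logTransform κ A t ≤ A * t := by
  unfold logTransform
  rw [div_le_iff₀ hκ]
  have := Real.log_le_sub_one_of_pos (x := 1 + κ * A * t) (by positivity)
  linarith

/-- First and second order information at a point where a test function touches from below the
strictly concave transform of an infimal convolution of an `∞`-supersolution. -/
theorem IsInftySuper.of_touching_logTransform (hΩo : IsOpen Ω) (hK : IsCompact K)
    (hΩK : Ω ⊆ K) (hs : ContinuousOn s K) (hs0 : ∀ x ∈ K, 0 ≤ s x) {Λ : ℝ}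
    (h : IsInftySuper Ω Λ s) {a κ A : ℝ} (ha : 0 ≤ a) (hκ : 0 < κ) (hA : 0 < A)
    {φ : EuclideanSpace ℝ (Fin n) → ℝ} {x₀ y₀ : EuclideanSpace ℝ (Fin n)}
    (hφ : ContDiffAt ℝ 2 φ x₀)
    (hmin : IsLocalMin (fun y => logTransform κ A (infConv K s a y) - φ y) x₀)
    (hy₀ : y₀ ∈ Ω) (hy : infConv K s a x₀ = s y₀ + a * ‖x₀ - y₀‖ ^ 2) :
    A * (Λ * Real.exp (s y₀)) ≤
        Real.exp (κ * logTransform κ A (infConv K s a x₀)) * ‖gradient φ x₀‖ ∧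
      hessQ φ x₀ ≤ -(κ * ‖gradient φ x₀‖ ^ 4) ∧ lapl φ x₀ ≤ n * (2 * a * A) := by
  have hS0 := infConv_nonneg hK ⟨y₀, hΩK hy₀⟩ hs hs0 ha
  set w := fun y => logTransform κ A (infConv K s a y) with hw
  set c := w x₀ - φ x₀ with hc
  have hwc : φ x₀ + c = w x₀ := by rw [hc]; ring
  obtain ⟨h1, h2, h3, h4⟩ := derivatives_exp_comp hφ hκ hA c
  rw [hwc] at h2 h3 h4
  have hmin' : IsLocalMin (fun y => infConv K s a y -
      (Real.exp (κ * (φ y + c)) - 1) / (κ * A)) x₀ := by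
    filter_upwards [hmin] with y hy
    have e1 : (Real.exp (κ * (φ x₀ + c)) - 1) / (κ * A) = infConv K s a x₀ := by
      rw [hwc, hw, exp_logTransform hκ hA (hS0 x₀)]; field_simp; ring
    have e2 : (Real.exp (κ * (φ y + c)) - 1) / (κ * A) ≤ infConv K s a y := by
      rw [div_le_iff₀ (by positivity)]
      have e3 : Real.exp (κ * (φ y + c)) ≤ Real.exp (κ * w y) := by
        gcongr
        have : w x₀ - φ x₀ ≤ w y - φ y := hy
        linarith
      rw [hw, exp_logTransform hκ hA (hS0 y)] at e3
      linarith
    rw [e1]; linarith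
  obtain ⟨g1, g2, g3⟩ := h.of_touching_infConv hΩo hK hΩK hs h1 hmin' hy₀ hy
  have hθ1 : 1 ≤ Real.exp (κ * w x₀) :=
    Real.one_le_exp (mul_nonneg hκ.le (logTransform_nonneg hκ hA (hS0 x₀)))
  have hθ : 0 < Real.exp (κ * w x₀) / A := by positivity
  refine ⟨?_, ?_, lapl_le fun b => ?_⟩
  · rw [h2] at g1
    calc A * (Λ * Real.exp (s y₀)) ≤ A * (Real.exp (κ * w x₀) / A * ‖gradient φ x₀‖) := by
          gcongr
      _ = Real.exp (κ * w x₀) * ‖gradient φ x₀‖ := by field_simp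
  · rw [h3] at g2
    have := nonpos_of_mul_nonpos_right g2 (by positivity)
    linarith
  · have e1 := (h4 b).trans (g3 b)
    have e2 : 0 ≤ 2 * a * ‖b‖ ^ 2 := by positivity
    rw [div_mul_eq_mul_div, div_le_iff₀ hA] at e1
    by_cases hb : 0 ≤ iteratedFDeriv ℝ 2 φ x₀ ![b, b]
    · nlinarith
    · have : 0 ≤ 2 * a * A * ‖b‖ ^ 2 := by positivity
      linarith

theorem sq_le_neg_factor {p κ Λ N L l q : ℝ} (hp : 2 ≤ p) (hκ : 0 ≤ κ) (hΛ : 0 ≤ Λ)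
    (hN : Λ ≤ N) (hq : q ≤ -(κ * N ^ 4)) (hl : l ≤ L) (hL : L + 1 ≤ (p - 2) * (κ * Λ ^ 2)) :
    N ^ 2 * 1 ≤ -(N ^ 2 * l + (p - 2) * q) := by
  have hp2 : 0 ≤ p - 2 := by linarith
  have h1 : (p - 2) * q ≤ (p - 2) * -(κ * N ^ 4) := by gcongr
  have h2 : N ^ 2 * l ≤ N ^ 2 * L := by gcongr
  have h3 : (p - 2) * (κ * Λ ^ 2) ≤ (p - 2) * (κ * N ^ 2) := by gcongr
  have h4 : N ^ 2 * (L + 1) ≤ N ^ 2 * ((p - 2) * (κ * N ^ 2)) := by gcongr; exact hL.trans h3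
  linarith

/-- `∞`-supersolutions below `1` asymptotically dominate rescaled minimal solutions. -/
theorem eventually_le_isInftySuper_add (hΩo : IsOpen Ω) (hΩb : Bornology.IsBounded Ω)
    (hne : Ω.Nonempty) {Λ m : ℝ} (hΛ : 0 < Λ) (hm1 : m < 1)
    (hs : ContinuousOn s (closure Ω)) (hs0 : ∀ x ∈ closure Ω, 0 ≤ s x)
    (hsm : ∀ x ∈ closure Ω, s x ≤ m) (h : IsInftySuper Ω Λ s)
    {b : EuclideanSpace ℝ (Fin n) → ℝ} (hb : ContinuousOn b (closure Ω))
    (hb0 : ∀ x ∈ frontier Ω, b x = 0)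
    {p lam : ℕ → ℝ} (hp4 : ∀ k, 4 < p k) (hp : Tendsto p atTop atTop)
    (hlam : ∀ k, 0 < lam k)
    (hscale : Tendsto (fun k => lam k ^ (1 / p k) / p k) atTop (𝓝 Λ))
    {u : ℕ → EuclideanSpace ℝ (Fin n) → ℝ}
    (hucl : ∀ k, u k ∈ PSuperClass Ω (p k) (lam k))
    (hu : ∀ᶠ k in atTop, ∀ s ∈ PSuperClass Ω (p k) (lam k), ∀ x ∈ closure Ω, u k x ≤ s x)
    (hub : ∀ᶠ k in atTop, ∀ x ∈ closure Ω, u k x / p k ≤ b x) {ε' : ℝ} (hε' : 0 < ε') :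
    ∀ᶠ k in atTop, ∀ x ∈ closure Ω, u k x / p k ≤ s x + ε' := by
  have hK : IsCompact (closure Ω) := hΩb.isCompact_closure
  have hΩK : Ω ⊆ closure Ω := subset_closure
  have hm0 : 0 ≤ m := by
    obtain ⟨x, hx⟩ := hne
    exact (hs0 x (hΩK hx)).trans (hsm x (hΩK hx))
  obtain ⟨δ, hδ0, hδε, hδm⟩ : ∃ δ : ℝ, 0 < δ ∧ δ ≤ ε' / 2 ∧ δ ≤ (1 - m) / 2 :=
    ⟨min (ε' / 2) ((1 - m) / 2), lt_min (by linarith) (by linarith), min_le_left _ _,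
      min_le_right _ _⟩
  set A := 1 + δ with hA
  have hA0 : 0 < A := by linarith
  obtain ⟨σ, hσ, hσ0⟩ : ∃ σ, Real.log A = σ + δ * m ∧ 0 < σ := by
    refine ⟨Real.log A - δ * m, by ring, ?_⟩
    have h1 := Real.one_sub_inv_le_log_of_pos hA0
    have h2 : 1 - A⁻¹ = δ * A⁻¹ := by rw [hA]; field_simp; ring
    have h3 : m < A⁻¹ := by
      rw [← one_div, lt_div_iff₀ hA0, hA]
      nlinarith
    have h4 : 0 < δ * (A⁻¹ - m) := mul_pos hδ0 (by linarith)
    linarith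
  set κ := σ / 5 / A with hκ
  have hκ0 : 0 < κ := by positivity
  have hκA : κ * A = σ / 5 := by rw [hκ]; field_simp
  obtain ⟨ε, hε0, hεσ, hεε⟩ : ∃ ε : ℝ, 0 < ε ∧ ε ≤ σ / 5 ∧ ε ≤ ε' / 2 :=
    ⟨min (σ / 5) (ε' / 2), lt_min (by linarith) (by linarith), min_le_left _ _, min_le_right _ _⟩
  obtain ⟨ρ₁, hρ₁, hsρ⟩ := Metric.uniformContinuousOn_iff.1
    (hK.uniformContinuousOn_of_continuous hs) (σ / 5) (by positivity)
  obtain ⟨ρ₂, hρ₂, hbρ⟩ := Metric.uniformContinuousOn_iff.1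
    (hK.uniformContinuousOn_of_continuous hb) ε hε0
  set ρ := min ρ₁ ρ₂ with hρ
  have hρ0 : 0 < ρ := lt_min hρ₁ hρ₂
  set a := 1 / ρ ^ 2 with ha
  have ha0 : 0 < a := by positivity
  set S := infConv (closure Ω) s a with hSdef
  have hS0 : ∀ x, 0 ≤ S x := infConv_nonneg hK hne.closure hs hs0 ha0.le
  have hSs : ∀ x ∈ closure Ω, S x ≤ s x := fun x hx => infConv_le_self hK hs hx
  set w := fun x => logTransform κ A (S x) with hw
  have hw0 : ∀ x, 0 ≤ w x := fun x => logTransform_nonneg hκ0 hA0 (hS0 x)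
  have hwS : ∀ x, w x ≤ A * S x := fun x => logTransform_le hκ0 hA0 (hS0 x)
  have hwc : Continuous w := by
    have h1 : Continuous S := continuous_infConv hK hs
    have h2 : ∀ x, 1 + κ * A * S x ≠ 0 := fun x => by
      have := hS0 x
      positivity
    exact ((continuous_const.add (continuous_const.mul h1)).log h2).div_const κ
  have hws : ∀ x ∈ closure Ω, w x ≤ s x + δ * m := fun x hx => by
    have h1 := hwS x
    have h2 := hSs x hx
    have h3 := hsm x hx
    have h4 : A * S x ≤ S x + δ * m := by rw [hA]; nlinarith
    linarith
  set L := n * (2 * a * A) with hL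
  have hev := eventually_scaled_le hp hΛ (fun k => by
    have := hlam k
    have := hp4 k
    have : 0 < p k := by linarith
    positivity) hscale (Λ' := Λ * Real.exp (σ / 5))
    (by nlinarith [Real.add_one_lt_exp (x := σ / 5) (by positivity)])
    (Real.exp_pos (2 + ε)) one_pos
  filter_upwards [hev, hu, hub, hp.eventually_ge_atTop ((L + 1) / (κ * Λ ^ 2) + 2)]
    with k hk huk hubk hpk
  have hp0 : 0 < p k := by linarith [hp4 k]
  have hcl : (fun x => min (u k x) (p k * (w x + ε))) ∈ PSuperClass Ω (p k) (lam k) := by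
    refine ⟨(hucl k).1.inf (by fun_prop), fun x hx => ?_, ?_⟩
    · show min (u k x) (p k * (w x + ε)) = 0
      rw [(hucl k).2.1 x hx]
      have := hw0 x
      exact min_eq_left (by positivity)
    refine (hucl k).2.2.min hΩo fun x₀ hx₀ hlt ψ hψ hmin => ?_
    obtain ⟨φ, hφ, rfl⟩ : ∃ φ : EuclideanSpace ℝ (Fin n) → ℝ, ContDiff ℝ 2 φ ∧
        ψ = fun y => p k * φ y :=
      ⟨fun y => ψ y / p k, hψ.div_const _, by ext y; field_simp⟩
    rw [le_neg_pOp_scaled_iff hp0 (hlam k) hφ.contDiffAt]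
    have hx₀K := hΩK hx₀
    obtain ⟨y₀, hy₀K, hy₀, -⟩ := infConv_attained (a := a) hK hne.closure hs x₀
    have hdist : dist x₀ y₀ < ρ := by
      rw [dist_eq_norm]
      have h1 : a * ‖x₀ - y₀‖ ^ 2 < 1 := by
        have := hs0 y₀ hy₀K
        have := hSs x₀ hx₀K
        have := hsm x₀ hx₀K
        linarith
      rw [ha, div_mul_eq_mul_div, one_mul, div_lt_one (by positivity)] at h1
      exact lt_of_pow_lt_pow_left₀ 2 hρ0.le h1
    have hy₀Ω : y₀ ∈ Ω := by
      by_contra hcon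
      have hfr : y₀ ∈ frontier Ω := by
        rw [hΩo.frontier_eq]; exact ⟨hy₀K, hcon⟩
      have h1 := hbρ x₀ hx₀K y₀ hy₀K (hdist.trans_le (min_le_right _ _))
      rw [hb0 y₀ hfr, Real.dist_eq, sub_zero] at h1
      have h2 := hubk x₀ hx₀K
      have h3 := (lt_div_iff₀' hp0).2 hlt
      have := hw0 x₀
      linarith [le_abs_self (b x₀)]
    have hmin' : IsLocalMin (fun y => w y - φ y) x₀ := by
      filter_upwards [hmin] with y hy
      have h1 : p k * (w x₀ - φ x₀) ≤ p k * (w y - φ y) := by linarith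
      exact le_of_mul_le_mul_left h1 hp0
    obtain ⟨g1, g2, g3⟩ := h.of_touching_logTransform hΩo hK hΩK hs hs0 ha0.le hκ0 hA0
      hφ.contDiffAt hmin' hy₀Ω hy₀
    set N := ‖gradient φ x₀‖ with hN
    have hS1 : S x₀ ≤ 1 := (hSs x₀ hx₀K).trans ((hsm x₀ hx₀K).trans hm1.le)
    have hwA : w x₀ ≤ A := (hwS x₀).trans (mul_le_of_le_one_right hA0.le hS1)
    have hNE : Λ * Real.exp (σ / 5) * Real.exp (w x₀ + ε) ≤ N := by
      have h1 : σ / 5 + (w x₀ + ε) + κ * w x₀ ≤ Real.log A + s y₀ := by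
        have e1 := hsρ x₀ hx₀K y₀ hy₀K (hdist.trans_le (min_le_left _ _))
        rw [Real.dist_eq] at e1
        have e2 := le_abs_self (s x₀ - s y₀)
        have e3 := hws x₀ hx₀K
        have e4 : κ * w x₀ ≤ κ * A := by gcongr
        linarith
      have h2 := Real.exp_le_exp.2 h1
      rw [Real.exp_add (_ + _), Real.exp_add (σ / 5), Real.exp_add (Real.log A),
        Real.exp_log hA0] at h2
      have h3 : Real.exp (κ * w x₀) * (Λ * Real.exp (σ / 5) * Real.exp (w x₀ + ε)) ≤
          Real.exp (κ * w x₀) * N := by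
        refine le_trans ?_ g1
        nlinarith
      exact le_of_mul_le_mul_left h3 (Real.exp_pos _)
    have hNΛ : Λ ≤ N := by
      refine le_trans ?_ hNE
      have h1 := Real.one_le_exp (x := σ / 5) (by positivity)
      have h2 := Real.one_le_exp (x := w x₀ + ε) (add_nonneg (hw0 x₀) hε0.le)
      rw [mul_assoc]
      exact le_mul_of_one_le_right hΛ.le (one_le_mul_of_one_le_of_one_le h1 h2)
    have hA2 : A ≤ 2 := by linarith
    refine (hk N (Real.exp (w x₀ + ε)) (Real.exp_pos _)
      (Real.exp_le_exp.2 (by linarith)) hNE).trans ?_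
    unfold pOp
    rw [← mul_neg, ← hN]
    gcongr
    refine sq_le_neg_factor (by linarith [hp4 k]) hκ0.le hΛ.le hNΛ g2 g3 ?_
    rw [← div_le_iff₀ (by positivity)]
    linarith
  intro x hx
  have h1 := (huk _ hcl x hx).trans (min_le_right _ _)
  rw [← div_le_iff₀' hp0] at h1
  have h2 := hws x hx
  have h3 : δ * m ≤ δ := mul_le_of_le_one_right hδ0.le hm1.le
  linarith

end UpperBound

section Convergence

variable {n : ℕ} {Ω : Set (EuclideanSpace ℝ (Fin n))}

/-- Arzelà–Ascoli along an ultrafilter, for asymptotically equicontinuous sequences. -/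
theorem exists_tendstoUniformlyOn_ultrafilter {α : Type*} [TopologicalSpace α] {K : Set α}
    (hK : IsCompact K) {F : ℕ → α → ℝ} (𝒰 : Ultrafilter ℕ)
    (hF : ∀ᶠ k in 𝒰, ∀ x ∈ K, F k x ∈ Icc (0 : ℝ) 1)
    (hequi : ∀ x ∈ K, ∀ ε > 0, ∃ t ∈ 𝓝[K] x, ∀ᶠ k in 𝒰, ∀ y ∈ t, |F k y - F k x| ≤ ε) :
    ∃ v, ContinuousOn v K ∧ TendstoUniformlyOn F v 𝒰 K := by
  have hlim : ∀ x ∈ K, ∃ l, Tendsto (fun k => F k x) 𝒰 (𝓝 l) := fun x hx => by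
    obtain ⟨l, -, hl⟩ := (isCompact_Icc (a := (0 : ℝ)) (b := 1)).ultrafilter_le_nhds
      (𝒰.map fun k => F k x) (le_principal_iff.2 (hF.mono fun k hk => hk x hx))
    exact ⟨l, hl⟩
  have : ∃ v : α → ℝ, ∀ x ∈ K, Tendsto (fun k => F k x) 𝒰 (𝓝 (v x)) := by
    choose! v hv using hlim
    exact ⟨v, hv⟩
  obtain ⟨v, hv⟩ := this
  have hequi' : ∀ x ∈ K, ∀ ε > 0, ∃ t ∈ 𝓝[K] x, (∀ᶠ k in 𝒰, ∀ y ∈ t, |F k y - F k x| ≤ ε) ∧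
      ∀ y ∈ t, |v y - v x| ≤ ε := fun x hx ε hε => by
    obtain ⟨t, ht, h⟩ := hequi x hx ε hε
    refine ⟨t ∩ K, inter_mem ht self_mem_nhdsWithin,
      h.mono fun k hk y hy => hk y hy.1, fun y hy => ?_⟩
    exact le_of_tendsto (((hv y hy.2).sub (hv x hx)).abs) (h.mono fun k hk => hk y hy.1)
  refine ⟨v, fun x hx => ?_, ?_⟩
  · refine Metric.tendsto_nhds.2 fun ε hε => ?_
    obtain ⟨t, ht, -, h⟩ := hequi' x hx (ε / 2) (by positivity)
    filter_upwards [ht] with y hy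
    rw [Real.dist_eq]
    linarith [h y hy]
  · rw [← tendstoLocallyUniformlyOn_iff_tendstoUniformlyOn_of_compact hK,
      Metric.tendstoLocallyUniformlyOn_iff]
    intro ε hε x hx
    obtain ⟨t, ht, h1, h2⟩ := hequi' x hx (ε / 4) (by positivity)
    refine ⟨t, ht, ?_⟩
    filter_upwards [h1, Metric.tendsto_nhds.1 (hv x hx) (ε / 4) (by positivity)] with k h3 h4 y hy
    have h5 := abs_le.1 (h2 y hy)
    have h6 := abs_le.1 (h3 y hy)
    rw [Real.dist_eq] at h4 ⊢
    have h7 := abs_lt.1 h4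
    rw [abs_lt]
    constructor <;> linarith

theorem HolderConeBound.exists_nhds_abs_sub_le {x : EuclideanSpace ℝ (Fin n)} (hΩo : IsOpen Ω)
    (hx : x ∈ Ω) {ε : ℝ} (hε : 0 < ε) :
    ∃ t ∈ 𝓝 x, ∀ f : EuclideanSpace ℝ (Fin n) → ℝ, HolderConeBound Ω f → (∀ y ∈ Ω, f y ≤ 1) →
      ∀ y ∈ t, |f y - f x| ≤ ε := by
  obtain ⟨r, hr, hball⟩ := Metric.nhds_basis_closedBall.mem_iff.1 (hΩo.mem_nhds hx)
  have hr2 : 0 < r / 2 := by positivity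
  have hc : Continuous fun y =>
      1 * ((‖y - x‖ ^ 2) ^ (1 / 4 : ℝ) / ((r / 2) ^ 2) ^ (1 / 4 : ℝ)) := by
    refine continuous_const.mul (Continuous.div_const (Continuous.rpow_const (by fun_prop) ?_) _)
    exact fun _ => Or.inr (by norm_num)
  have h0 : ∀ᶠ y in 𝓝 x,
      1 * ((‖y - x‖ ^ 2) ^ (1 / 4 : ℝ) / ((r / 2) ^ 2) ^ (1 / 4 : ℝ)) < ε := by
    refine hc.continuousAt.eventually_lt_const ?_
    have : ((0 : ℝ) ^ 2) ^ (1 / 4 : ℝ) = 0 := by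
      rw [zero_pow two_ne_zero, Real.zero_rpow (by norm_num)]
    simpa [sub_self, norm_zero] using hε
  refine ⟨_, inter_mem h0 (closedBall_mem_nhds x hr2), fun f hf hf1 y hy => ?_⟩
  refine (hf.abs_sub_le hf1 hr2 ?_ hy.2).trans (le_of_lt hy.1)
  rwa [mul_div_cancel₀ _ two_ne_zero]

theorem exists_exponent_lt {R Λ : ℝ} (hΛ : Λ < 1 / (Real.exp 1 * R)) :
    ∃ m, 0 < m ∧ m < 1 ∧ Λ < m ^ 2 / R * Real.exp (-m) := by
  have hc : ContinuousAt (fun m : ℝ => m ^ 2 / R * Real.exp (-m)) 1 := by fun_prop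
  have h1 : Λ < (1 : ℝ) ^ 2 / R * Real.exp (-1) := by
    rw [Real.exp_neg]
    convert hΛ using 1
    rw [one_pow, one_div, one_div, mul_inv, mul_comm]
  have h2 : ∀ᶠ m in 𝓝[<] (1 : ℝ), Λ < m ^ 2 / R * Real.exp (-m) :=
    (hc.eventually_const_lt h1).filter_mono nhdsWithin_le_nhds
  obtain ⟨m, h3, h4⟩ := (h2.and (Ioo_mem_nhdsLT (show (0 : ℝ) < 1 by norm_num))).exists
  exact ⟨m, h4.1, h4.2, h3⟩

theorem infDist_frontier_le_sSup (hΩb : Bornology.IsBounded Ω) {x : EuclideanSpace ℝ (Fin n)}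
    (hx : x ∈ Ω) :
    infDist x (frontier Ω) ≤ sSup ((fun x => infDist x (frontier Ω)) '' Ω) := by
  refine le_csSup ?_ ⟨x, hx, rfl⟩
  refine (hΩb.isCompact_closure.bddAbove_image
    (continuous_infDist_pt (frontier Ω)).continuousOn).mono (image_mono subset_closure)

end Convergence

/-- Minimal solutions of the `p_k`-Gelfand problem, rescaled by
`1/p_k`, converge uniformly to the minimal solution of the limit problem when
`λ_k^{1/p_k}/p_k → Λ ∈ (0, Λ_max)`. -/
theorem minimal_solutions_convergence {n : ℕ} (Ω : Set (EuclideanSpace ℝ (Fin n)))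
    (hΩo : IsOpen Ω) (hΩb : Bornology.IsBounded Ω)
    (RΩ : ℝ) (hR : RΩ = sSup ((fun x => infDist x (frontier Ω)) '' Ω))
    (Λ : ℝ) (hΛ : 0 < Λ) (hΛmax : Λ < 1 / (Real.exp 1 * RΩ))
    (p lam : ℕ → ℝ) (hp4 : ∀ k, 4 < p k) (hp : Tendsto p atTop atTop)
    (hlam : ∀ k, 0 < lam k)
    (hscale : Tendsto (fun k => lam k ^ (1 / p k) / p k) atTop (𝓝 Λ))
    (u : ℕ → EuclideanSpace ℝ (Fin n) → ℝ)
    (hu_cont : ∀ k, ContinuousOn (u k) (closure Ω))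
    (hu_sol : ∀ k, IsPSol Ω (p k) (lam k) (u k))
    (hu_bdry : ∀ k, ∀ x ∈ frontier Ω, u k x = 0)
    (hu_min : ∀ k, ∀ w : EuclideanSpace ℝ (Fin n) → ℝ,
      ContinuousOn w (closure Ω) → (∀ x ∈ frontier Ω, w x = 0) →
      IsPSol Ω (p k) (lam k) w → ∀ x ∈ closure Ω, u k x ≤ w x)
    (uΛ : EuclideanSpace ℝ (Fin n) → ℝ)
    (huΛ_cont : ContinuousOn uΛ (closure Ω))
    (huΛ_bdry : ∀ x ∈ frontier Ω, uΛ x = 0)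
    (huΛ_sol : IsInftySol Ω Λ uΛ)
    (huΛ_min : ∀ w : EuclideanSpace ℝ (Fin n) → ℝ,
      ContinuousOn w (closure Ω) → (∀ x ∈ frontier Ω, w x = 0) →
      IsInftySol Ω Λ w → ∀ x ∈ closure Ω, uΛ x ≤ w x) :
    TendstoUniformlyOn (fun k x => u k x / p k) uΛ atTop (closure Ω) := by
  obtain rfl | hne := Ω.eq_empty_or_nonempty
  · simpa using tendstoUniformlyOn_empty
  have hK : IsCompact (closure Ω) := hΩb.isCompact_closure
  have hΩK : Ω ⊆ closure Ω := subset_closure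
  have hR0 : 0 < RΩ := by
    by_contra hcon
    have : 1 / (Real.exp 1 * RΩ) ≤ 0 :=
      one_div_nonpos.2 (mul_nonpos_of_nonneg_of_nonpos (Real.exp_pos 1).le (not_lt.1 hcon))
    linarith
  have hfr : (frontier Ω).Nonempty := by
    by_contra hcon
    rw [not_nonempty_iff_eq_empty] at hcon
    rw [hR, hcon] at hR0
    simp [hne.image_const] at hR0
  have hRle : ∀ x ∈ Ω, infDist x (frontier Ω) ≤ RΩ := fun x hx =>
    hR ▸ infDist_frontier_le_sSup hΩb hx
  have hRle' : ∀ x ∈ closure Ω, infDist x (frontier Ω) ≤ RΩ :=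
    closure_minimal hRle (isClosed_le (continuous_infDist_pt _) continuous_const)
  obtain ⟨m, hm0, hm1, hm⟩ := exists_exponent_lt hΛmax
  have hp0 : ∀ k, 0 < p k := fun k => by linarith [hp4 k]
  have hucl : ∀ k, u k ∈ PSuperClass Ω (p k) (lam k) := fun k =>
    ⟨hu_cont k, hu_bdry k, (hu_sol k).1⟩
  have hu0 : ∀ k, ∀ x ∈ closure Ω, 0 ≤ u k x := fun k =>
    (hu_sol k).1.nonneg hΩo hΩb (hp4 k) (hlam k) (hu_cont k) (hu_bdry k)
  have hu : ∀ᶠ k in atTop, ∀ s ∈ PSuperClass Ω (p k) (lam k), ∀ x ∈ closure Ω,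
      u k x ≤ s x := by
    filter_upwards [hp.eventually_ge_atTop (2 * n + 2)] with k hk s hs
    exact le_of_isPSuper_of_minimal hΩo hΩb (hp4 k) hk (hlam k) (hu_min k) hs
  set b := boundaryBarrier Ω RΩ m with hb
  have hbc : Continuous b := continuous_boundaryBarrier Ω RΩ hm0
  have hb0 : ∀ x ∈ frontier Ω, b x = 0 := fun x hx => boundaryBarrier_eq_zero RΩ hm0 hx
  have hbm : ∀ x ∈ closure Ω, b x ≤ m := fun x hx => boundaryBarrier_le hR0 hm0 (hRle' x hx)
  have hub : ∀ᶠ k in atTop, ∀ x ∈ closure Ω, u k x / p k ≤ b x :=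
    eventually_le_boundaryBarrier hΩo hΩb hfr hR0 hRle hΛ hm0 hm1 hm hp4 hp hlam hscale hu
  have hequi : ∀ x ∈ closure Ω, ∀ ε > 0, ∃ t ∈ 𝓝[closure Ω] x, ∀ᶠ k in atTop, ∀ y ∈ t,
      |u k y / p k - u k x / p k| ≤ ε := fun x hx ε hε => by
    by_cases hxΩ : x ∈ Ω
    · obtain ⟨t, ht, h⟩ := HolderConeBound.exists_nhds_abs_sub_le hΩo hxΩ hε
      refine ⟨t, mem_nhdsWithin_of_mem_nhds ht, ?_⟩
      filter_upwards [hub, hp.eventually_ge_atTop (2 * n + 2)] with k h1 h2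
      refine h (fun y => u k y / p k) (fun y r hr hball z hz => ?_)
        fun y hy => (h1 y (hΩK hy)).trans ((hbm y (hΩK hy)).trans hm1.le)
      have h3 := (hu_sol k).1.holderConeBound h2 (hlam k) ((hu_cont k).mono hΩK)
        (fun x hx => hu0 k x (hΩK hx)) y r hr hball z hz
      have h4 := div_le_div_of_nonneg_right h3 (hp0 k).le
      rw [sub_div, mul_div_right_comm] at h4
      exact h4
    · have hxf : x ∈ frontier Ω := by
        rw [hΩo.frontier_eq]; exact ⟨hx, hxΩ⟩
      have h1 : ∀ᶠ y in 𝓝 x, b y < ε :=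
        hbc.continuousAt.eventually_lt_const (by rwa [hb0 x hxf])
      refine ⟨{y | b y < ε} ∩ closure Ω, inter_mem (mem_nhdsWithin_of_mem_nhds h1)
        self_mem_nhdsWithin, ?_⟩
      filter_upwards [hub] with k h2 y hy
      rw [hu_bdry k x hxf, zero_div, sub_zero,
        abs_of_nonneg (div_nonneg (hu0 k y hy.2) (hp0 k).le)]
      exact (h2 y hy.2).trans hy.1.le
  have hlimit : ∀ 𝒰 : Ultrafilter ℕ, ↑𝒰 ≤ (atTop : Filter ℕ) → ∃ v,
      TendstoUniformlyOn (fun k x => u k x / p k) v 𝒰 (closure Ω) ∧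
      ∀ x ∈ closure Ω, uΛ x ≤ v x ∧ v x ≤ m := fun 𝒰 h𝒰 => by
    obtain ⟨v, hvc, hv⟩ := exists_tendstoUniformlyOn_ultrafilter hK
      (F := fun k x => u k x / p k) 𝒰 ((hub.filter_mono h𝒰).mono fun k hk x hx =>
        ⟨div_nonneg (hu0 k x hx) (hp0 k).le, (hk x hx).trans ((hbm x hx).trans hm1.le)⟩)
      fun x hx ε hε => by
        obtain ⟨t, ht, h⟩ := hequi x hx ε hε
        exact ⟨t, ht, h.filter_mono h𝒰⟩
    have hvb : ∀ x ∈ closure Ω, 0 ≤ v x ∧ v x ≤ b x := fun x hx =>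
      ⟨ge_of_tendsto (hv.tendsto_at hx) (Eventually.of_forall fun k =>
        div_nonneg (hu0 k x hx) (hp0 k).le),
        le_of_tendsto (hv.tendsto_at hx) ((hub.filter_mono h𝒰).mono fun k hk => hk x hx)⟩
    have hvf : ∀ x ∈ frontier Ω, v x = 0 := fun x hx =>
      le_antisymm ((hvb x (frontier_subset_closure hx)).2.trans_eq (hb0 x hx))
        (hvb x (frontier_subset_closure hx)).1
    have huc : ∀ k, ContinuousOn (u k) Ω := fun k => (hu_cont k).mono hΩK
    have hvsol : IsInftySol Ω Λ v :=
      ⟨isInftySuper_of_tendstoUniformlyOn hΩo hp0 (hp.mono_left h𝒰) hlam (hscale.mono_left h𝒰)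
        huc (fun k => (hu_sol k).1) (hvc.mono hΩK) (hv.mono hΩK),
      isInftySub_of_tendstoUniformlyOn hΩo hΛ hp0 (hp.mono_left h𝒰) hlam
        (hscale.mono_left h𝒰) huc (fun k => (hu_sol k).2) (hvc.mono hΩK) (hv.mono hΩK)⟩
    exact ⟨v, hv, fun x hx => ⟨huΛ_min v hvc hvf hvsol x hx, (hvb x hx).2.trans (hbm x hx)⟩⟩
  have huΛ0 : ∀ x ∈ closure Ω, 0 ≤ uΛ x := huΛ_sol.1.nonneg hΩo hΩb hΛ huΛ_cont huΛ_bdry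
  have huΛm : ∀ x ∈ closure Ω, uΛ x ≤ m := fun x hx => by
    obtain ⟨v, -, hv⟩ := hlimit (Ultrafilter.of atTop) (Ultrafilter.of_le _)
    exact (hv x hx).1.trans (hv x hx).2
  rw [Metric.tendstoUniformlyOn_iff]
  intro ε hε
  have hupper := eventually_le_isInftySuper_add hΩo hΩb hne hΛ hm1 huΛ_cont huΛ0 huΛm huΛ_sol.1
    hbc.continuousOn hb0 hp4 hp hlam hscale hucl hu hub (half_pos hε)
  refine mem_iff_ultrafilter.2 fun 𝒰 h𝒰 => ?_
  obtain ⟨v, hv, hle⟩ := hlimit 𝒰 h𝒰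
  filter_upwards [hupper.filter_mono h𝒰, Metric.tendstoUniformlyOn_iff.1 hv ε hε]
    with k h1 h2 x hx
  have h3 := h1 x hx
  have h4 := h2 x hx
  have h5 := (hle x hx).1
  rw [Real.dist_eq, abs_lt] at h4 ⊢
  constructor <;> linarith
end

section
/- Let Ω ⊆ ℝⁿ be a bounded open set, R_Ω := sup_{x ∈ Ω} dist(x, ∂Ω), and Λ₁ := 1/R_Ω. Let Λ > 0 and let u be a continuous viscosity solution of min{|∇u| − Λ e^{u}, −Δ_∞ u} = 0 in Ω with u = 0 on ∂Ω, and suppose Λ₁ · sup u − Λ e^{sup u} ≥ 0. Then u(x) ≤ (sup u / R_Ω) · dist(x, ∂Ω) for all x ∈ Ω. -/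
open Real Set Metric Filter Topology

/-- The derivative of a radial function `h (‖x - y‖²)`. -/
theorem hasFDerivAt_comp_norm_sub_sq {E : Type*} [NormedAddCommGroup E] [InnerProductSpace ℝ E]
    {h h₁ : ℝ → ℝ} (hh : ∀ s, HasDerivAt h (h₁ s) s) (y x : E) :
    HasFDerivAt (fun x => h (‖x - y‖ ^ 2))
      ((2 * h₁ (‖x - y‖ ^ 2)) • innerSL ℝ (x - y)) x := by
  have h1 : HasFDerivAt (fun x : E => ‖x - y‖ ^ 2) (2 • innerSL ℝ (x - y)) x := by
    simpa using ((hasFDerivAt_id x).sub_const y).norm_sq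
  refine ((hh _).comp_hasFDerivAt x h1).congr_fderiv ?_
  ext v
  simp
  ring

theorem gradient_comp_norm_sub_sq {n : ℕ} {h h₁ : ℝ → ℝ} (hh : ∀ s, HasDerivAt h (h₁ s) s)
    (y x : EuclideanSpace ℝ (Fin n)) :
    gradient (fun x => h (‖x - y‖ ^ 2)) x = (2 * h₁ (‖x - y‖ ^ 2)) • (x - y) := by
  refine HasGradientAt.gradient ?_
  rw [hasGradientAt_iff_hasFDerivAt]
  refine (hasFDerivAt_comp_norm_sub_sq hh y x).congr_fderiv ?_
  ext v
  simp

theorem hessQ_comp_norm_sub_sq {n : ℕ} {h h₁ h₂ : ℝ → ℝ} (hh : ∀ s, HasDerivAt h (h₁ s) s)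
    (hh₁ : ∀ s, HasDerivAt h₁ (h₂ s) s) (y x : EuclideanSpace ℝ (Fin n)) :
    hessQ (fun x => h (‖x - y‖ ^ 2)) x =
      (2 * h₁ (‖x - y‖ ^ 2)) ^ 2 *
        (2 * h₁ (‖x - y‖ ^ 2) * ‖x - y‖ ^ 2 + 4 * h₂ (‖x - y‖ ^ 2) * (‖x - y‖ ^ 2) ^ 2) := by
  have hfd : fderiv ℝ (fun x => h (‖x - y‖ ^ 2)) =
      fun x => (2 * h₁ (‖x - y‖ ^ 2)) • innerSL ℝ (x - y) :=
    funext fun z => (hasFDerivAt_comp_norm_sub_sq hh y z).fderiv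
  have hL : HasFDerivAt (fun x : EuclideanSpace ℝ (Fin n) => innerSL ℝ (x - y))
      (innerSL ℝ : EuclideanSpace ℝ (Fin n) →L[ℝ] _) x := by
    exact (innerSL ℝ : EuclideanSpace ℝ (Fin n) →L[ℝ] _).hasFDerivAt.comp x
      ((hasFDerivAt_id x).sub_const y)
  have h2 : fderiv ℝ (fun x => (2 * h₁ (‖x - y‖ ^ 2)) • innerSL ℝ (x - y)) x = _ :=
    (((hasFDerivAt_comp_norm_sub_sq hh₁ y x).const_mul 2).smul hL).fderiv
  rw [hessQ, gradient_comp_norm_sub_sq hh, iteratedFDeriv_two_apply, hfd, h2]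
  generalize x - y = v
  have hv : innerSL ℝ v v = ‖v‖ ^ 2 := real_inner_self_eq_norm_sq v
  simp [hv]
  ring

/-- The third-order Taylor polynomial of the square root at `1` lies above it. -/
theorem le_taylor_sqrt {t : ℝ} (ht : 0 ≤ t) :
    t ≤ 1 + (t ^ 2 - 1) / 2 - (t ^ 2 - 1) ^ 2 / 8 + (t ^ 2 - 1) ^ 3 / 16 := by
  have h : 0 ≤ (t - 1) ^ 4 * (t ^ 2 + 4 * t + 5) := by positivity
  nlinarith [h]

/-- A subsolution vanishing on the boundary lies below every strictly concave, sufficiently steep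
radial profile centred at a boundary point. -/
theorem IsInftySub.le_concave_cone {n : ℕ} {Ω : Set (EuclideanSpace ℝ (Fin n))}
    (hΩo : IsOpen Ω) (hΩb : Bornology.IsBounded Ω) {Λ : ℝ} (hΛ : 0 < Λ)
    {u : EuclideanSpace ℝ (Fin n) → ℝ} (hu_cont : ContinuousOn u (closure Ω))
    (hu : IsInftySub Ω Λ u) (hu_bdry : ∀ x ∈ frontier Ω, u x = 0)
    {S : ℝ} (hS : ∀ x ∈ Ω, u x ≤ S) {y : EuclideanSpace ℝ (Fin n)} (hy : y ∈ frontier Ω)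
    {D : ℝ} (hD : ∀ x ∈ closure Ω, ‖x - y‖ ≤ D) {c ε : ℝ} (hε : 0 < ε)
    (hc : Λ * Real.exp S < c - 2 * ε * D) {x : EuclideanSpace ℝ (Fin n)} (hx : x ∈ closure Ω) :
    u x ≤ c * ‖x - y‖ - ε * ‖x - y‖ ^ 2 := by
  obtain ⟨x₀, hx₀, hmax⟩ := hΩb.isCompact_closure.exists_isMaxOn ⟨x, hx⟩
    (f := fun z => u z - (c * ‖z - y‖ - ε * ‖z - y‖ ^ 2)) (by fun_prop)
  have hmax' : ∀ z ∈ closure Ω, u z - (c * ‖z - y‖ - ε * ‖z - y‖ ^ 2) ≤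
      u x₀ - (c * ‖x₀ - y‖ - ε * ‖x₀ - y‖ ^ 2) := fun z hz => hmax hz
  by_contra! hlt
  have hpos := (sub_pos.2 hlt).trans_le (hmax' x hx)
  have hr := hD x₀ hx₀
  have hr_nonneg := norm_nonneg (x₀ - y)
  have hexp : 0 < Λ * Real.exp S := by positivity
  have hεr : ε * ‖x₀ - y‖ ≤ ε * D := by gcongr
  have hεr_nonneg : 0 ≤ ε * ‖x₀ - y‖ := by positivity
  have hx₀Ω : x₀ ∈ Ω := by
    by_contra hn
    have hf : x₀ ∈ frontier Ω := by
      rw [hΩo.frontier_eq]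
      exact ⟨hx₀, hn⟩
    rw [hu_bdry x₀ hf] at hpos
    nlinarith [mul_nonneg hr_nonneg (show 0 ≤ c - ε * ‖x₀ - y‖ by linarith)]
  have hne : x₀ ≠ y := by
    rintro rfl
    rw [hΩo.frontier_eq] at hy
    exact hy.2 hx₀Ω
  set r := ‖x₀ - y‖ with hr_def
  have hr_pos : 0 < r := norm_pos_iff.2 (sub_ne_zero.2 hne)
  let h : ℝ → ℝ := fun s => c * (r * (1 + (s / r ^ 2 - 1) / 2 - (s / r ^ 2 - 1) ^ 2 / 8 +
    (s / r ^ 2 - 1) ^ 3 / 16)) - ε * s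
  let h₁ : ℝ → ℝ := fun s => c * (r * (1 / r ^ 2 / 2 - 2 * (s / r ^ 2 - 1) * (1 / r ^ 2) / 8 +
    3 * (s / r ^ 2 - 1) ^ 2 * (1 / r ^ 2) / 16)) - ε
  let h₂ : ℝ → ℝ := fun s => c * (r * (- (2 * (1 / r ^ 2) * (1 / r ^ 2) / 8) +
    3 * (2 * (s / r ^ 2 - 1) * (1 / r ^ 2)) * (1 / r ^ 2) / 16))
  have hq (s : ℝ) : HasDerivAt (fun s => s / r ^ 2 - 1) (1 / r ^ 2) s :=
    ((hasDerivAt_id s).div_const _).sub_const 1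
  have hh (s : ℝ) : HasDerivAt h (h₁ s) s := by
    have := ((((((hq s).div_const 2).const_add 1).sub (((hq s).pow 2).div_const 8)).add
      (((hq s).pow 3).div_const 16)).const_mul r |>.const_mul c).sub
      ((hasDerivAt_id s).const_mul ε)
    refine this.congr_deriv ?_
    simp [h₁]
  have hh₁ (s : ℝ) : HasDerivAt h₁ (h₂ s) s := by
    have := ((((((hq s).const_mul 2).mul_const (1 / r ^ 2)).div_const 8).const_sub
      (1 / r ^ 2 / 2)).add (((((hq s).pow 2).const_mul 3).mul_const (1 / r ^ 2)).div_const 16)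
      |>.const_mul r |>.const_mul c).sub_const ε
    refine this.congr_deriv ?_
    simp [h₂]
  have hh₁r : h₁ (r ^ 2) = (c - 2 * ε * r) / (2 * r) := by
    simp only [h₁]
    field_simp
    ring
  have hh₂r : h₂ (r ^ 2) = - c / (4 * r ^ 3) := by
    simp only [h₂]
    field_simp
    ring
  have hsmooth : ContDiff ℝ 2 h := by
    simp only [h]
    fun_prop
  have hcomp : ContDiff ℝ 2 fun z => h (‖z - y‖ ^ 2) :=
    hsmooth.comp ((contDiff_id.sub contDiff_const).norm_sq ℝ)
  have hloc : IsLocalMaxOn (fun z => u z - h (‖z - y‖ ^ 2)) Ω x₀ := by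
    refine IsMaxOn.localize fun z hz => ?_
    have hz' := hmax' z (subset_closure hz)
    have ht := le_taylor_sqrt (t := ‖z - y‖ / r) (by positivity)
    have hc_pos : 0 < c * r := mul_pos (by linarith) hr_pos
    have ht' := mul_le_mul_of_nonneg_left ht hc_pos.le
    have e1 : c * r * (‖z - y‖ / r) = c * ‖z - y‖ := by field_simp
    have e2 : h (r ^ 2) = c * r - ε * r ^ 2 := by
      simp only [h]
      field_simp
      ring
    rw [e1, div_pow] at ht'
    simp only [Set.mem_ofPred_eq]
    rw [← hr_def, e2]
    simp only [h]
    linarith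
  have hsub := hu x₀ hx₀Ω _ hcomp hloc
  rw [gradient_comp_norm_sub_sq hh, hessQ_comp_norm_sub_sq hh hh₁, norm_smul, ← hr_def, hh₁r,
    hh₂r] at hsub
  have hslope : 0 < c - 2 * ε * r := by linarith
  have hexp_le : Λ * Real.exp (u x₀) ≤ Λ * Real.exp S := by
    gcongr
    exact hS x₀ hx₀Ω
  have e3 : ‖2 * ((c - 2 * ε * r) / (2 * r))‖ * r = c - 2 * ε * r := by
    rw [Real.norm_of_nonneg (by positivity)]
    field_simp
  have e4 : -((2 * ((c - 2 * ε * r) / (2 * r))) ^ 2 *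
      (2 * ((c - 2 * ε * r) / (2 * r)) * r ^ 2 + 4 * (- c / (4 * r ^ 3)) * (r ^ 2) ^ 2)) =
      2 * ε * (c - 2 * ε * r) ^ 2 := by
    field_simp
    ring
  rw [e3, e4] at hsub
  exact absurd hsub (not_le.2 (lt_min (by linarith) (by positivity)))

/-- Any solution `u` of the limit problem with
`Λ₁·sup u − Λ e^{sup u} ≥ 0` lies below the cone `(sup u / R_Ω)·dist(·, ∂Ω)`. -/
theorem solutions_below_cone {n : ℕ} (Ω : Set (EuclideanSpace ℝ (Fin n)))
    (hΩo : IsOpen Ω) (hΩb : Bornology.IsBounded Ω)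
    (RΩ : ℝ) (hR : RΩ = sSup ((fun x => infDist x (frontier Ω)) '' Ω))
    (Λ : ℝ) (hΛ : 0 < Λ)
    (u : EuclideanSpace ℝ (Fin n) → ℝ)
    (hu_cont : ContinuousOn u (closure Ω))
    (hu_sol : IsInftySol Ω Λ u)
    (hu_bdry : ∀ x ∈ frontier Ω, u x = 0)
    (S : ℝ) (hS : S = sSup (u '' closure Ω))
    (hcurve : 0 ≤ (1 / RΩ) * S - Λ * Real.exp S) :
    ∀ x ∈ Ω, u x ≤ (S / RΩ) * infDist x (frontier Ω) := by
  intro x hx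
  have hR0 : RΩ ≠ 0 := by
    rintro rfl
    have : 0 < Λ * Real.exp S := by positivity
    simp at hcurve
    linarith
  have hne : (frontier Ω).Nonempty := by
    by_contra hn
    rw [not_nonempty_iff_eq_empty] at hn
    refine hR0 ?_
    simp [hR, hn, Set.Nonempty.image_const ⟨x, hx⟩]
  have hbdd : BddAbove (u '' closure Ω) :=
    (hΩb.isCompact_closure.image_of_continuousOn hu_cont).bddAbove
  have huS : ∀ z ∈ Ω, u z ≤ S := fun z hz =>
    hS ▸ le_csSup hbdd (mem_image_of_mem u (subset_closure hz))
  have hcomp : IsCompact (frontier Ω) :=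
    hΩb.isCompact_closure.of_isClosed_subset isClosed_frontier frontier_subset_closure
  obtain ⟨y, hy, hxy⟩ := hcomp.exists_infDist_eq_dist hne x
  obtain ⟨D, hD⟩ := isBounded_iff.1 hΩb.closure
  have hDy : ∀ z ∈ closure Ω, ‖z - y‖ ≤ D := fun z hz => by
    rw [← dist_eq_norm]
    exact hD hz (frontier_subset_closure hy)
  have hxc := subset_closure hx
  have hD0 : 0 ≤ D := (norm_nonneg _).trans (hDy x hxc)
  rw [hxy, dist_eq_norm]
  have hslope : Λ * Real.exp S ≤ S / RΩ := by
    rw [one_div_mul_eq_div] at hcurve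
    linarith
  have hlim : Tendsto (fun ε : ℝ => (S / RΩ + 2 * ε * D + ε) * ‖x - y‖ - ε * ‖x - y‖ ^ 2)
      (𝓝[>] 0) (𝓝 (S / RΩ * ‖x - y‖)) := by
    refine tendsto_nhdsWithin_of_tendsto_nhds (Continuous.tendsto' (by fun_prop) _ _ (by simp))
  refine ge_of_tendsto hlim ?_
  filter_upwards [self_mem_nhdsWithin] with ε hε
  have hε' : 0 < ε := hε
  exact hu_sol.2.le_concave_cone hΩo hΩb hΛ hu_cont hu_bdry huS hy hDy hε' (by linarith) hxc
end
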